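/- arXiv:1811.11986 — 3 statements merged into one kernel-verified Lean document; each statement's English description precedes it below -/
import Mathlib

section
/- Suppose 2·N_c ≥ L and N_c ≤ L. For every real ε > 0 there exists K₀ such that for every K ≥ K₀, every cell association C_1,…,C_K with |C_i| ≤ N_c, and every combinatorial uplink zero-forcing scheme (D, ≺) for it, the number of decoding pairs satisfies |D| ≤ ((N_c + 1)/(L + 2) + ε)·K. (Converse part of Theorem 1 for the range L/2 ≤ N_c ≤ L: the asymptotic uplink zero-forcing per-user DoF is at most (N_c+1)/(L+2).) -/
/-- MT `i` is connected to BS `j` iff `i - L ≤ j ≤ i` (truncated subtraction). -/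
def Connected (L i j : ℕ) : Prop := i - L ≤ j ∧ j ≤ i

/-- `C` is a valid cell association for a `K`-user network with per-MT constraint `Nc`. -/
def IsCellAssoc (K Nc : ℕ) (C : ℕ → Finset ℕ) : Prop :=
  ∀ i ∈ Finset.Icc 1 K, C i ⊆ Finset.Icc 1 K ∧ (C i).card ≤ Nc

/-- A combinatorial uplink zero-forcing scheme for the association `C`:
a finite set `D` of decoding pairs `(i, j)` (message `W i` decoded at BS `j`)
with a strict linear order `lt` on `D` such that
(a) every pair satisfies `j ∈ C i` and BS `j` is connected to MT `i`;
(b) distinct pairs differ in both coordinates;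
(c) for pairs `(i,j), (i',j')` with `i ≠ i'`, if BS `j'` is connected to MT `i`
then `j' ∈ C i` and `(i,j)` precedes `(i',j')`. -/
structure UplinkScheme (K L : ℕ) (C : ℕ → Finset ℕ) where
  D : Finset (ℕ × ℕ)
  lt : ℕ × ℕ → ℕ × ℕ → Prop
  lt_irrefl : ∀ p ∈ D, ¬ lt p p
  lt_trans : ∀ p ∈ D, ∀ q ∈ D, ∀ r ∈ D, lt p q → lt q r → lt p r
  lt_total : ∀ p ∈ D, ∀ q ∈ D, p ≠ q → lt p q ∨ lt q p
  mem_range : ∀ p ∈ D, p.1 ∈ Finset.Icc 1 K ∧ p.2 ∈ Finset.Icc 1 K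
  assoc : ∀ p ∈ D, p.2 ∈ C p.1
  conn : ∀ p ∈ D, Connected L p.1 p.2
  distinct : ∀ p ∈ D, ∀ q ∈ D, p ≠ q → p.1 ≠ q.1 ∧ p.2 ≠ q.2
  zf : ∀ p ∈ D, ∀ q ∈ D, p.1 ≠ q.1 → Connected L p.1 q.2 → q.2 ∈ C p.1 ∧ lt p q

/-- MT `i` is active in the uplink scheme: some pair `(i, j)` is in `D`. -/
def UplinkScheme.ActiveMT {K L : ℕ} {C : ℕ → Finset ℕ} (S : UplinkScheme K L C) (i : ℕ) : Prop :=
  i ∈ S.D.image Prod.fst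

/-- BS `j` is active in the uplink scheme: some pair `(i, j)` is in `D`. -/
def UplinkScheme.ActiveBS {K L : ℕ} {C : ℕ → Finset ℕ} (S : UplinkScheme K L C) (j : ℕ) : Prop :=
  j ∈ S.D.image Prod.snd

/-- Position `j` lies in a `U`-run ending at a cut `k`, in a residue class that may be lost. -/
def BadPos (N : ℕ) (V : ℕ → Prop) (u : ℕ → ℕ) (j : ℕ) : Prop :=
  ∃ k, j < k ∧ (∀ t, j ≤ t → t < k → ¬ V t) ∧ V k ∧
    ¬ (j ≡ k [MOD N]) ∧ ¬ (j + u k ≡ k [MOD N])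

theorem not_bad_of_run {N : ℕ} {V : ℕ → Prop} {u : ℕ → ℕ} {j k : ℕ} (hjk : j < k)
    (hr : ∀ t, j ≤ t → t < k → ¬ V t) (hk : V k)
    (h : j ≡ k [MOD N] ∨ j + u k ≡ k [MOD N]) : ¬ BadPos N V u j := by
  rintro ⟨k', h1, h2, h3, h4, h5⟩
  have hkk : k = k' := by
    rcases lt_trichotomy k k' with h' | h' | h'
    · exact absurd hk (h2 k hjk.le h')
    · exact h'
    · exact absurd h3 (hr k' h1.le h')
  subst hkk
  rcases h with h | h
  · exact h4 h
  · exact h5 h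

theorem not_bad_of_V {N : ℕ} {V : ℕ → Prop} {u : ℕ → ℕ} {j : ℕ} (hj : V j) :
    ¬ BadPos N V u j := by
  rintro ⟨k', h1, h2, -⟩
  exact h2 j le_rfl h1 hj

theorem b_step {b : ℕ → ℕ} (h0 : ∀ j, b j + 1 ≤ b (j + 1)) (i d : ℕ) : b i + d ≤ b (i + d) := by
  induction d with
  | zero => simp
  | succ d ih =>
    have := h0 (i + d)
    rw [← add_assoc i d 1]
    omega

theorem jump_arith {N P s : ℕ} (hN : 2 ≤ N) (hP2 : 2 ≤ P) (hP : P ≤ 2 * N)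
    (hs2 : s + 2 ≤ 2 * N) : P * s + 2 * N ≤ N * (P + s) := by
  rcases le_or_gt P N with h | h
  · have h1 : P * s ≤ N * s := Nat.mul_le_mul_right _ h
    have h2 : N * 2 ≤ N * P := Nat.mul_le_mul_left _ hP2
    nlinarith
  · obtain ⟨c, rfl⟩ := Nat.exists_eq_add_of_lt h
    have h1 : (s + 2) * (c + 1) ≤ 2 * N * (c + 1) := Nat.mul_le_mul_right _ hs2
    obtain ⟨M, rfl⟩ := Nat.exists_eq_add_of_le hN
    obtain ⟨f, hf⟩ := Nat.exists_eq_add_of_le hP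
    nlinarith

/-- One step of the walk along positions of non-decreasing excess. -/
theorem walk_step {N P : ℕ} (hN : 2 ≤ N) (hP2 : 2 ≤ P) (hP : P ≤ 2 * N) {b : ℕ → ℕ}
    {V : ℕ → Prop} {u : ℕ → ℕ}
    (h0 : ∀ j, b j + 1 ≤ b (j + 1))
    (hV : ∀ j, V j → b j + P ≤ b (j + N))
    (hU : ∀ j, ¬ V (j + N - 1) → b j + P ≤ b (j + N))
    (hu : ∀ k, 1 ≤ u k ∧ u k < N)
    (hW : ∀ j k, j + u k = k → b j + P ≤ b (j + N))
    (hVU : ∀ j, V j → ¬ V (j + 1) → b j + P ≤ b (j + 2))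
    (i : ℕ) (hi : ¬ BadPos N V u i) :
    ∃ m, i + N ≤ m ∧ m + 2 ≤ i + 2 * N ∧ ¬ BadPos N V u m ∧
      N * b i + P * (m - i) ≤ N * b m := by
  classical
  have hjump : b i + P ≤ b (i + N) := by
    by_cases hVi : V i
    · exact hV i hVi
    by_cases hUi : V (i + N - 1)
    swap
    · exact hU i hUi
    have hex : ∃ d, V (i + d) := ⟨N - 1, by rwa [← Nat.add_sub_assoc (by omega)]⟩
    have hd := Nat.find_spec hex
    have hmin := fun m => Nat.find_min hex (m := m)
    have hle : Nat.find hex ≤ N - 1 :=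
      Nat.find_min' hex (by rwa [← Nat.add_sub_assoc (by omega)])
    generalize Nat.find hex = d at hd hmin hle
    have hdpos : d ≠ 0 := by
      rintro rfl
      exact hVi hd
    apply hW i (i + d)
    by_contra hne
    apply hi
    refine ⟨i + d, by omega, ?_, hd, ?_, ?_⟩
    · intro t h1 h2 h3
      obtain ⟨s, rfl⟩ := Nat.exists_eq_add_of_le h1
      exact hmin s (by omega) h3
    · intro h
      have h' : i + 0 ≡ i + d [MOD N] := h
      have := Nat.ModEq.add_left_cancel' _ h'
      have := Nat.ModEq.eq_of_lt_of_lt this (by omega) (by omega)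
      omega
    · intro h
      have := Nat.ModEq.add_left_cancel' _ h
      have := Nat.ModEq.eq_of_lt_of_lt this (hu _).2 (by omega)
      omega
  by_cases hb : BadPos N V u (i + N)
  swap
  · refine ⟨i + N, le_rfl, by omega, hb, ?_⟩
    rw [Nat.add_sub_cancel_left]
    nlinarith
  obtain ⟨k, hk1, hk2, hk3, hk4, hk5⟩ := hb
  -- there is a VU descent in between
  have hdesc : ∃ t, i ≤ t ∧ t < i + N ∧ V t ∧ ¬ V (t + 1) := by
    by_contra hno
    push Not at hno
    have hall : ∀ s, s ≤ N → ¬ V (i + N - s) := by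
      intro s
      induction s with
      | zero => intro _; exact hk2 _ (by omega) (by omega)
      | succ s ih =>
        intro hs hv
        have h1 := hno (i + N - (s + 1)) (by omega) (by omega) hv
        apply ih (by omega)
        have : i + N - (s + 1) + 1 = i + N - s := by omega
        rwa [this] at h1
    apply hi
    refine ⟨k, by omega, ?_, hk3, ?_, ?_⟩
    · intro t h1 h2
      rcases lt_or_ge t (i + N) with h | h
      · have := hall (i + N - t) (by omega)
        have e : i + N - (i + N - t) = t := by omega
        rwa [e] at this
      · exact hk2 t h h2
    · intro h
      apply hk4
      simpa [Nat.ModEq] using h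
    · intro h
      apply hk5
      have e : i + N + u k = i + u k + N := by omega
      rw [e]
      simpa [Nat.ModEq] using h
  obtain ⟨t, ht1, ht2, ht3, ht4⟩ := hdesc
  have hfar : ∀ m, i + N < m → m + 2 ≤ i + 2 * N → N * b i + P * (m - i) ≤ N * b m := by
    intro m hm1 hm2
    have e1 := b_step h0 i (t - i)
    have e2 := hVU t ht3 ht4
    have e3 := b_step h0 (t + 2) (m - (t + 2))
    rw [show i + (t - i) = t by omega] at e1
    rw [show t + 2 + (m - (t + 2)) = m by omega] at e3
    have e4 : b i + (P + (m - i)) ≤ b m + 2 := by omega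
    have e5 := jump_arith (s := m - i) hN hP2 hP (by omega)
    have e6 : N * (b i + (P + (m - i))) ≤ N * (b m + 2) := Nat.mul_le_mul_left _ e4
    nlinarith
  rcases le_or_gt (k + 2) (i + 2 * N) with hk | hk
  · exact ⟨k, by omega, hk, not_bad_of_V hk3, hfar k (by omega) hk⟩
  · -- choose a good class
    have key : ∃ m, i + N < m ∧ m + 2 ≤ i + 2 * N ∧
        (m ≡ k [MOD N] ∨ m + u k ≡ k [MOD N]) := by
      have cls : ∀ c, ∃ m, i + N ≤ m ∧ m < i + N + N ∧ m + c ≡ k [MOD N] := by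
        intro c
        have hNz : (N : ℤ) ≠ 0 := by omega
        refine ⟨i + N + (((k : ℤ) - c - (i + N)) % N).toNat, by omega, ?_, ?_⟩
        · have := Int.emod_lt_of_pos ((k : ℤ) - c - (i + N)) (by omega : (0 : ℤ) < N)
          have := Int.emod_nonneg ((k : ℤ) - c - (i + N)) hNz
          omega
        · rw [← Int.natCast_modEq_iff]
          push_cast
          rw [Int.toNat_of_nonneg (Int.emod_nonneg _ hNz)]
          have := (Int.mod_modEq ((k : ℤ) - c - (i + N)) N).add_left (i + N + c : ℤ)
          have e : (i + N + c : ℤ) + ((k : ℤ) - c - (i + N)) = k := by ring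
          rw [e] at this
          convert this using 1
          ring
      obtain ⟨m1, a1, a2, a3⟩ := cls 0
      obtain ⟨m2, c1, c2, c3⟩ := cls (u k)
      have n1 : m1 ≠ i + N := by rintro rfl; exact hk4 a3
      have n2 : m2 ≠ i + N := by rintro rfl; exact hk5 c3
      by_cases hm : m1 + 2 ≤ i + 2 * N
      · exact ⟨m1, by omega, hm, Or.inl a3⟩
      · refine ⟨m2, by omega, ?_, Or.inr c3⟩
        by_contra hm'
        have e : m1 = m2 := by omega
        subst e
        have h' := Nat.ModEq.add_left_cancel' _ (a3.trans c3.symm)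
        have h'' := Nat.ModEq.eq_of_lt_of_lt h' (by omega) (hu k).2
        have := (hu k).1
        omega
    obtain ⟨m, m1, m2, m3⟩ := key
    exact ⟨m, by omega, m2,
      not_bad_of_run (k := k) (by omega) (fun t h1 h2 => hk2 t (by omega) h2) hk3 m3,
      hfar m m1 m2⟩

theorem walk_bound {N P : ℕ} (hN : 2 ≤ N) (hP2 : 2 ≤ P) (hP : P ≤ 2 * N) {b : ℕ → ℕ}
    {V : ℕ → Prop} {u : ℕ → ℕ}
    (h0 : ∀ j, b j + 1 ≤ b (j + 1))
    (hV : ∀ j, V j → b j + P ≤ b (j + N))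
    (hU : ∀ j, ¬ V (j + N - 1) → b j + P ≤ b (j + N))
    (hu : ∀ k, 1 ≤ u k ∧ u k < N)
    (hW : ∀ j k, j + u k = k → b j + P ≤ b (j + N))
    (hVU : ∀ j, V j → ¬ V (j + 1) → b j + P ≤ b (j + 2)) (n : ℕ) :
    P * n ≤ N * b n + 3 * N * P := by
  have start : ∃ i, i < N ∧ ¬ BadPos N V u i := by
    by_cases hb : BadPos N V u 0
    · obtain ⟨k, h1, h2, h3, h4, h5⟩ := hb
      refine ⟨k % N, Nat.mod_lt _ (by omega), ?_⟩
      rcases (Nat.mod_le k N).eq_or_lt with h | h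
      · rw [h]; exact not_bad_of_V h3
      · exact not_bad_of_run h (fun t _ h' => h2 t (by omega) h') h3
          (Or.inl (Nat.mod_modEq k N))
    · exact ⟨0, by omega, hb⟩
  have main : ∀ n, N ≤ n → ∃ i, i ≤ n ∧ n < i + 2 * N ∧ ¬ BadPos N V u i ∧
      P * i ≤ N * b i + N * P := by
    intro n hn
    induction n, hn using Nat.le_induction with
    | base =>
      obtain ⟨i, hi, hb⟩ := start
      refine ⟨i, by omega, by omega, hb, ?_⟩
      have : P * i ≤ P * N := Nat.mul_le_mul_left _ hi.le
      nlinarith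
    | succ n hn ih =>
      obtain ⟨i, h1, h2, h3, h4⟩ := ih
      by_cases h : n + 1 < i + 2 * N
      · exact ⟨i, by omega, h, h3, h4⟩
      · obtain ⟨m, m1, m2, m3, m4⟩ := walk_step hN hP2 hP h0 hV hU hu hW hVU i h3
        refine ⟨m, by omega, by omega, m3, ?_⟩
        obtain ⟨s, rfl⟩ := Nat.exists_eq_add_of_le (show i ≤ m by omega)
        rw [Nat.add_sub_cancel_left] at m4
        nlinarith
  rcases le_or_gt N n with hn | hn
  · obtain ⟨i, h1, h2, -, h4⟩ := main n hn
    have e := b_step h0 i (n - i)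
    rw [show i + (n - i) = n by omega] at e
    have e1 : N * b i ≤ N * b n := Nat.mul_le_mul_left _ (by omega)
    have e2 : P * n ≤ P * (i + 2 * N) := Nat.mul_le_mul_left _ h2.le
    nlinarith
  · have : P * n ≤ P * N := Nat.mul_le_mul_left _ hn.le
    nlinarith [Nat.zero_le (N * b n), Nat.zero_le (N * P)]

/-- The bound for infinite interleaved sequences. -/
theorem seq_bound {L Nc : ℕ} (hNc : 0 < Nc) (h1 : L ≤ 2 * Nc)
    {A B : ℕ → ℕ} (hB : ∀ k, B k < B (k + 1))
    (hAB : ∀ k, B k ≤ A k ∧ A k ≤ B k + L)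
    (hstep : ∀ k, A k < B (k + 1) ∨ B k + L < A (k + 1))
    (hcard : ∀ k x y, x ≤ k → k ≤ y → A k ≤ B x + L → B y ≤ A k → y + 1 ≤ x + Nc) (n : ℕ) :
    (L + 2) * n ≤ (Nc + 1) * B n + 3 * (Nc + 1) * (L + 2) := by
  have hu : ∀ k, ∃ u, (1 ≤ u ∧ u < Nc + 1) ∧
      ∀ j, j + u = k → B j + (L + 2) ≤ B (j + (Nc + 1)) := by
    intro k
    classical
    have hex : ∃ l, ∀ j, j + (l + 1) = k → B j + L < A k := ⟨k, fun j hj => by omega⟩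
    have hs := Nat.find_spec hex
    have hmin := fun m => Nat.find_min hex (m := m)
    generalize Nat.find hex = l at hs hmin
    have hl : l ≤ k ∧ A k ≤ B (k - l) + L := by
      rcases Nat.eq_zero_or_pos l with rfl | hl
      · exact ⟨by omega, (hAB k).2⟩
      · have := hmin (l - 1) (by omega)
        push Not at this
        obtain ⟨j, hj1, hj2⟩ := this
        have e : k - l = j := by omega
        rw [e]
        exact ⟨by omega, hj2⟩
    have hlN := hcard k (k - l) k (by omega) le_rfl hl.2 (hAB k).1
    refine ⟨l + 1, ⟨by omega, by omega⟩, ?_⟩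
    intro j hj
    have e1 := hs j hj
    have e2 : A k < B (j + (Nc + 1)) := by
      by_contra hc
      have := hcard k (k - l) (j + (Nc + 1)) (by omega) (by omega) hl.2 (by omega)
      omega
    omega
  choose u hu1 hu2 using hu
  refine walk_bound (N := Nc + 1) (P := L + 2) (V := fun j => B j + L < A (j + 1)) (u := u)
    (by omega) (by omega) (by omega) hB ?_ ?_ hu1 (fun j k h => hu2 k j h) ?_ n
  · intro j hj
    have e2 : A (j + 1) < B (j + (Nc + 1)) := by
      by_contra hc
      have := hcard (j + 1) (j + 1) (j + (Nc + 1)) le_rfl (by omega) (hAB _).2 (by omega)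
      omega
    have : B j + L < A (j + 1) := hj
    omega
  · intro j hj
    have hj' := (hstep (j + (Nc + 1) - 1)).resolve_right hj
    rw [show j + (Nc + 1) - 1 + 1 = j + (Nc + 1) by omega,
      show j + (Nc + 1) - 1 = j + Nc by omega] at hj'
    have e2 : B j + L < A (j + Nc) := by
      by_contra hc
      have := hcard (j + Nc) j (j + Nc) (by omega) le_rfl (by omega) (hAB _).1
      omega
    omega
  · intro j hj hj2
    have hj' : B j + L < A (j + 1) := hj
    have := (hstep (j + 1)).resolve_right hj2
    have : A (j + 1) < B (j + 2) := this
    omega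

theorem scheme_bound {K L Nc : ℕ} (hNc : 0 < Nc) (h1 : L ≤ 2 * Nc)
    {C : ℕ → Finset ℕ} (hC : IsCellAssoc K Nc C) (S : UplinkScheme K L C) :
    (L + 2) * S.D.card ≤ (Nc + 1) * K + (3 * (Nc + 1) + 1) * (L + 2) := by
  classical
  have conn : ∀ p ∈ S.D, p.2 ≤ p.1 ∧ p.1 ≤ p.2 + L := by
    intro p hp
    have := S.conn p hp
    unfold Connected at this
    omega
  have nocross : ∀ p ∈ S.D, ∀ q ∈ S.D, p ≠ q → p.1 ≤ q.2 + L → q.2 ≤ p.1 →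
      q.1 ≤ p.2 + L → p.2 ≤ q.1 → False := by
    intro p hp q hq hne a1 a2 a3 a4
    have hd := (S.distinct p hp q hq hne).1
    have e1 := (S.zf p hp q hq hd ⟨by omega, by omega⟩).2
    have e2 := (S.zf q hq p hp hd.symm ⟨by omega, by omega⟩).2
    exact S.lt_irrefl p hp (S.lt_trans p hp q hq p hp e1 e2)
  have mono : ∀ p ∈ S.D, ∀ q ∈ S.D, p.2 < q.2 → p.1 < q.1 := by
    intro p hp q hq h
    by_contra hc
    have hne : p ≠ q := by rintro rfl; omega
    have := conn p hp
    have := conn q hq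
    exact nocross p hp q hq hne (by omega) (by omega) (by omega) (by omega)
  have hinj : Set.InjOn Prod.snd (S.D : Set (ℕ × ℕ)) := by
    intro p hp q hq h
    by_contra hne
    exact (S.distinct p hp q hq hne).2 h
  set n := S.D.card with hn
  have hcardim : (S.D.image Prod.snd).card = n := Finset.card_image_of_injOn hinj
  let b : Fin n ↪o ℕ := (S.D.image Prod.snd).orderEmbOfFin hcardim
  have hex : ∀ k : Fin n, ∃ a, (a, b k) ∈ S.D := by
    intro k
    have := (S.D.image Prod.snd).orderEmbOfFin_mem hcardim k
    obtain ⟨p, hp, hpe⟩ := Finset.mem_image.1 this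
    refine ⟨p.1, ?_⟩
    have : p = (p.1, b k) := Prod.ext rfl hpe
    rwa [← this]
  choose a ha using hex
  let A : ℕ → ℕ := fun k => if h : k < n then a ⟨k, h⟩ else K + (k - n + 1) * (L + 1)
  let B : ℕ → ℕ := fun k => if h : k < n then b ⟨k, h⟩ else K + (k - n + 1) * (L + 1)
  have hAB_in : ∀ k, k < n → (A k, B k) ∈ S.D := by
    intro k hk
    simp only [A, B, hk, dif_pos]
    exact ha _
  have hA_out : ∀ k, n ≤ k → A k = K + (k - n + 1) * (L + 1) := by
    intro k hk
    simp only [A, dif_neg (not_lt.2 hk)]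
  have hB_out : ∀ k, n ≤ k → B k = K + (k - n + 1) * (L + 1) := by
    intro k hk
    simp only [B, dif_neg (not_lt.2 hk)]
  have hB_in_le : ∀ k, k < n → B k ≤ K ∧ A k ≤ K := by
    intro k hk
    have := S.mem_range _ (hAB_in k hk)
    simp only [Finset.mem_Icc] at this
    omega
  have hBlt_in : ∀ x y, x < y → y < n → B x < B y := by
    intro x y hxy hy
    simp only [B, hy, hxy.trans hy, dif_pos]
    exact b.strictMono hxy
  have hB_gap : ∀ k, n ≤ k + 1 → B k + L < B (k + 1) := by
    intro k hk
    rw [hB_out (k + 1) hk]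
    rcases lt_or_ge k n with h | h
    · have := (hB_in_le k h).1
      nlinarith [Nat.zero_le ((k + 1 - n) * (L + 1))]
    · rw [hB_out k h, show k + 1 - n = k - n + 1 by omega]
      nlinarith
  have hB : ∀ k, B k < B (k + 1) := by
    intro k
    rcases lt_or_ge (k + 1) n with h | h
    · exact hBlt_in k (k + 1) (by omega) h
    · have := hB_gap k h
      omega
  have hBm : StrictMono B := strictMono_nat_of_lt_succ hB
  have hABc : ∀ k, B k ≤ A k ∧ A k ≤ B k + L := by
    intro k
    rcases lt_or_ge k n with h | h
    · exact conn _ (hAB_in k h)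
    · rw [hA_out k h, hB_out k h]
      omega
  have hstep : ∀ k, A k < B (k + 1) ∨ B k + L < A (k + 1) := by
    intro k
    rcases lt_or_ge (k + 1) n with h | h
    · by_contra hc
      push Not at hc
      have m1 := hAB_in k (by omega)
      have m2 := hAB_in (k + 1) h
      have c1 := hABc k
      have c2 := hABc (k + 1)
      have c3 := hB k
      have c4 := mono _ m1 _ m2 c3
      simp only at c4
      refine nocross _ m1 _ m2 ?_ ?_ ?_ ?_ ?_
      · intro he
        have := congrArg Prod.snd he
        simp only at this
        omega
      all_goals simp only; omega
    · right
      have := hB_gap k h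
      have := (hABc (k + 1)).1
      omega
  have hcard : ∀ k x y, x ≤ k → k ≤ y → A k ≤ B x + L → B y ≤ A k → y + 1 ≤ x + Nc := by
    intro k x y hx hy e1 e2
    rcases lt_or_ge k n with h | h
    · have hyn : y < n := by
        by_contra hyn
        have := hB_out y (by omega)
        have := (hB_in_le k h).2
        nlinarith [Nat.zero_le ((y - n) * (L + 1))]
      have hk := hAB_in k h
      have hsub : (Finset.Icc x y).image B ⊆ C (A k) := by
        intro z hz
        obtain ⟨m, hm, rfl⟩ := Finset.mem_image.1 hz
        rw [Finset.mem_Icc] at hm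
        by_cases hmk : m = k
        · subst hmk
          exact S.assoc _ hk
        · have hm' := hAB_in m (by omega)
          have hne : (A k, B k) ≠ (A m, B m) := by
            intro he
            have := congrArg Prod.snd he
            exact hmk (hBm.injective this).symm
          have hd := (S.distinct _ hk _ hm' hne).1
          have g1 := hBm.monotone hm.1
          have g2 := hBm.monotone hm.2
          exact (S.zf _ hk _ hm' hd ⟨by simp only; omega, by simp only; omega⟩).1
      have hc1 := Finset.card_le_card hsub
      rw [Finset.card_image_of_injective _ hBm.injective, Nat.card_Icc] at hc1
      have hc2 := (hC (A k) (S.mem_range _ hk).1).2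
      omega
    · have hAk : A k = B k := by rw [hA_out k h, hB_out k h]
      have hyk : y = k := by
        have := hBm.le_iff_le.1 (e2.trans hAk.le)
        omega
      have hxk : x = k := by
        by_contra hne
        have g1 := hB_gap (k - 1) (by omega)
        rw [show k - 1 + 1 = k by omega] at g1
        have g2 := hBm.monotone (show x ≤ k - 1 by omega)
        omega
      omega
  have hfin := seq_bound hNc h1 hB hABc hstep hcard (n - 1)
  rcases Nat.eq_zero_or_pos n with h | h
  · rw [h]
    simp
  · have := (hB_in_le (n - 1) (by omega)).1
    have e : (Nc + 1) * B (n - 1) ≤ (Nc + 1) * K := Nat.mul_le_mul_left _ this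
    obtain ⟨m, hm⟩ := Nat.exists_eq_add_of_lt h
    rw [hm] at hfin e ⊢
    simp only [zero_add, Nat.add_sub_cancel] at hfin e ⊢
    nlinarith

/-- Converse part of Theorem 1 for `L/2 ≤ Nc ≤ L`: the asymptotic uplink zero-forcing
per-user DoF is at most `(Nc+1)/(L+2)`. -/
theorem uplink_mid_range_converse (L Nc : ℕ) (hL : 0 < L) (hNc : 0 < Nc)
    (h1 : L ≤ 2 * Nc) (h2 : Nc ≤ L) :
    ∀ ε : ℝ, 0 < ε → ∃ K₀ : ℕ, ∀ K : ℕ, K₀ ≤ K →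
      ∀ C : ℕ → Finset ℕ, IsCellAssoc K Nc C →
        ∀ S : UplinkScheme K L C,
          (S.D.card : ℝ) ≤ (((Nc : ℝ) + 1) / ((L : ℝ) + 2) + ε) * (K : ℝ) := by
  intro ε hε
  refine ⟨⌈(3 * ((Nc : ℝ) + 1) + 1) / ε⌉₊, ?_⟩
  intro K hK C hC S
  have h := scheme_bound hNc h1 hC S
  have h' : ((L : ℝ) + 2) * S.D.card ≤
      ((Nc : ℝ) + 1) * K + (3 * ((Nc : ℝ) + 1) + 1) * ((L : ℝ) + 2) := by
    exact_mod_cast h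
  have hK' : 3 * ((Nc : ℝ) + 1) + 1 ≤ ε * K := by
    have := Nat.ceil_le.1 hK
    rw [div_le_iff₀ hε] at this
    linarith
  have hLp : (0 : ℝ) < (L : ℝ) + 2 := by positivity
  have e : (((Nc : ℝ) + 1) / ((L : ℝ) + 2) + ε) * K =
      (((Nc : ℝ) + 1) * K + ε * K * ((L : ℝ) + 2)) / ((L : ℝ) + 2) := by
    field_simp
  rw [e, le_div_iff₀ hLp]
  nlinarith
end

section
/- Suppose 1 ≤ N_c and 2·N_c < L. For every real ε > 0 there exists K₀ such that for every K ≥ K₀, every cell association C_1,…,C_K with |C_i| ≤ N_c, and every combinatorial uplink zero-forcing scheme (D, ≺) for it, the number of decoding pairs satisfies |D| ≤ (2N_c/(2N_c + L) + ε)·K. (Converse part of Theorem 1 for the range N_c < L/2: the asymptotic uplink zero-forcing per-user DoF is at most 2N_c/(2N_c + L).) -/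
theorem aux_mult (D : ℕ → ℝ) (σ : ℝ) (hσ : 0 ≤ σ) (M x : ℕ) (j : ℕ)
    (h : ∀ i < j, D (x + i * M) + σ ≤ D (x + i * M + M)) :
    D x ≤ D (x + j * M) ∧ (1 ≤ j → D x + σ ≤ D (x + j * M)) := by
  induction j with
  | zero => simp
  | succ j ih =>
    have h1 := (ih (fun i hi => h i (by omega))).1
    have h2 := h j (by omega)
    have e : x + (j + 1) * M = x + j * M + M := by ring
    rw [e]
    exact ⟨by linarith, fun _ => by linarith⟩

/-- one block step -/
theorem aux_step (N : ℕ) (hN : 1 ≤ N) (lam : ℝ) (hlam : 1 ≤ lam)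
    (D : ℕ → ℝ) (A B : ℕ → Prop) (σ : ℝ) (hσ : σ = ((N : ℝ) - 1) * (lam - 1))
    (hD : ∀ p r : ℕ, D p - r * lam ≤ D (p + r))
    (hA : ∀ x, A (x + N) → D x + σ ≤ D (x + N + 1))
    (hB : ∀ x, B x → D x + σ ≤ D (x + N + 1))
    (hBA : ∀ x, B x → A (x + 1) → D x + (2 * N - 2) * lam ≤ D (x + 2))
    (hE1 : ∀ x, D x - (N - 1) ≤ D (x + 2 * N))
    (hE2 : ∀ x, B (x + N - 1) ∨ D x - (N - 1) + lam ≤ D (x + 2 * N - 1))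
    (hAB : ∀ k, A k ∨ B k)
    (hAi : ∀ k, ∃ l, k < l ∧ A l) (hBi : ∀ k, ∃ l, k < l ∧ B l)
    (κ : ℝ) (t : ℕ) (hAt : A t)
    (hS : κ ≤ D (t + 1) ∨ (κ - lam ≤ D (t + 1) ∧ κ - (N - 1) ≤ D t)) :
    ∃ t', t < t' ∧ A t' ∧
      (κ ≤ D (t' + 1) ∨ (κ - lam ≤ D (t' + 1) ∧ κ - (N - 1) ≤ D t')) ∧
      ∀ p, t + 1 ≤ p → p ≤ t' → κ - (2 * N + 1) * lam ≤ D p := by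
  classical
  have hNr : (1 : ℝ) ≤ N := by exact_mod_cast hN
  have hσ0 : 0 ≤ σ := by rw [hσ]; exact mul_nonneg (by linarith) (by linarith)
  -- choose w
  obtain ⟨w, ⟨htw, hBw⟩, hwmin⟩ : ∃ w, (t < w ∧ B w) ∧ ∀ y, t < y → y < w → ¬ B y :=
    ⟨Nat.find (hBi t), Nat.find_spec (hBi t), fun y h1 h2 h3 => Nat.find_min (hBi t) h2 ⟨h1, h3⟩⟩
  obtain ⟨t', ⟨hwt, hAt'⟩, htmin⟩ : ∃ t', (w < t' ∧ A t') ∧ ∀ y, w < y → y < t' → ¬ A y :=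
    ⟨Nat.find (hAi w), Nat.find_spec (hAi w), fun y h1 h2 h3 => Nat.find_min (hAi w) h2 ⟨h1, h3⟩⟩
  have hArun : ∀ y, t ≤ y → y < w → A y := by
    intro y h1 h2
    rcases Nat.eq_or_lt_of_le h1 with h | h
    · rw [← h]; exact hAt
    · exact (hAB y).resolve_right (hwmin y h h2)
  have hBrun : ∀ y, w ≤ y → y < t' → B y := by
    intro y h1 h2
    rcases Nat.eq_or_lt_of_le h1 with h | h
    · rw [← h]; exact hBw
    · exact (hAB y).resolve_left (htmin y h h2)
  -- multi-step
  have mA : ∀ x j : ℕ, t ≤ x → x + j * (N + 1) ≤ w →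
      D x ≤ D (x + j * (N + 1)) ∧ (1 ≤ j → D x + σ ≤ D (x + j * (N + 1))) := by
    intro x j hx hj
    apply aux_mult D σ hσ0
    intro i hi
    have : (i + 1) * (N + 1) ≤ j * (N + 1) := Nat.mul_le_mul_right _ hi
    have e : (i + 1) * (N + 1) = i * (N + 1) + (N + 1) := by ring
    exact hA _ (hArun _ (by omega) (by omega))
  have mB : ∀ x j : ℕ, (w ≤ x ∨ B x) → w ≤ x + 1 → x + j * (N + 1) ≤ t' + N →
      D x ≤ D (x + j * (N + 1)) ∧ (1 ≤ j → D x + σ ≤ D (x + j * (N + 1))) := by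
    intro x j hx hx1 hj
    apply aux_mult D σ hσ0
    intro i hi
    have : (i + 1) * (N + 1) ≤ j * (N + 1) := Nat.mul_le_mul_right _ hi
    have e : (i + 1) * (N + 1) = i * (N + 1) + (N + 1) := by ring
    refine hB _ ?_
    rcases Nat.eq_zero_or_pos i with h0 | h0
    · subst h0
      rcases hx with hx | hx
      · exact hBrun _ (by omega) (by omega)
      · simpa using hx
    · have : 1 * (N + 1) ≤ i * (N + 1) := Nat.mul_le_mul_right _ h0
      exact hBrun _ (by omega) (by omega)
  -- intermediate bounds
  have hP0 : κ - lam ≤ D (t + 1) := by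
    rcases hS with h | h
    · linarith
    · exact h.1
  have dm : ∀ z : ℕ, ∃ q r : ℕ, z = q * (N + 1) + r ∧ r ≤ N := by
    intro z
    refine ⟨z / (N + 1), z % (N + 1), ?_, ?_⟩
    · have := Nat.div_add_mod z (N + 1); rw [mul_comm]; exact this.symm
    · exact Nat.lt_succ_iff.mp (Nat.mod_lt z (Nat.succ_pos N))
  have cast_le : ∀ r : ℕ, r ≤ N → (r : ℝ) * lam ≤ N * lam := by
    intro r hr
    have : (r : ℝ) ≤ N := by exact_mod_cast hr
    exact mul_le_mul_of_nonneg_right this (by linarith)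
  have iA : ∀ p, t + 1 ≤ p → p ≤ w → κ - lam - N * lam ≤ D p := by
    intro p h1 h2
    obtain ⟨q, r, hz, hr⟩ := dm (p - (t + 1))
    have e : p = t + 1 + q * (N + 1) + r := by omega
    have := (mA (t + 1) q (by omega) (by omega)).1
    have h3 := hD (t + 1 + q * (N + 1)) r
    rw [← e] at h3
    have := cast_le r hr
    linarith
  have iB : ∀ p, w ≤ p → p ≤ t' → κ - (2 * N + 1) * lam ≤ D p := by
    intro p h1 h2
    obtain ⟨q, r, hz, hr⟩ := dm (p - w)
    have e : p = w + q * (N + 1) + r := by omega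
    have := (mB w q (by omega) (by omega) (by omega)).1
    have h3 := hD (w + q * (N + 1)) r
    rw [← e] at h3
    have := cast_le r hr
    have := iA w (by omega) le_rfl
    linarith
  refine ⟨t', by omega, hAt', ?_, ?_⟩
  swap
  · intro p h1 h2
    rcases le_total p w with h | h
    · have := iA p h1 h
      have h4 : (0:ℝ) ≤ N * lam := by positivity
      linarith
    · exact iB p h h2
  -- main part
  obtain ⟨j, r, hjr, hr⟩ := dm (t' - 1 - w)
  obtain ⟨i, s, his, hs⟩ := dm (w - (t + 1))
  have hP1 : ∀ z, z ≤ D (w + r) → z + (2 * N - 2) * lam ≤ D (t' + 1) := by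
    intro z hz
    have h1 := (mB (w + r) j (by omega) (by omega) (by omega)).1
    have h2 := hBA (w + r + j * (N + 1)) (hBrun _ (by omega) (by omega))
      (by convert hAt' using 1; omega)
    have e : w + r + j * (N + 1) + 2 = t' + 1 := by omega
    rw [e] at h2
    linarith
  have hwr : D w - r * lam ≤ D (w + r) := hD w r
  have hQN : r = N → D w + σ ≤ D t' := by
    intro h
    have e : t' = w + (j + 1) * (N + 1) := by
      have : (j + 1) * (N + 1) = j * (N + 1) + (N + 1) := by ring
      omega
    have h1 := (mB w (j + 1) (by omega) (by omega) (by omega)).2 (by omega)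
    rwa [← e] at h1
  have hQN1 : r + 1 = N → B (w - 1) → D (w - 1) + σ ≤ D t' := by
    intro h hb
    have e : t' = (w - 1) + (j + 1) * (N + 1) := by
      have : (j + 1) * (N + 1) = j * (N + 1) + (N + 1) := by ring
      omega
    have h1 := (mB (w - 1) (j + 1) (by right; exact hb) (by omega) (by omega)).2 (by omega)
    rwa [← e] at h1
  have hws : D (t + 1) ≤ D (w - s) := by
    have h1 := (mA (t + 1) i (by omega) (by omega)).1
    have e : t + 1 + i * (N + 1) = w - s := by omega
    rwa [e] at h1
  have hw1 : D (t + 1) - s * lam ≤ D w := by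
    have h1 := hD (w - s) s
    have e : w - s + s = w := by omega
    rw [e] at h1
    linarith
  have hw2 : s = N → D t + σ ≤ D w := by
    intro h
    have e : w = t + (i + 1) * (N + 1) := by
      have : (i + 1) * (N + 1) = i * (N + 1) + (N + 1) := by ring
      omega
    have h1 := (mA t (i + 1) (by omega) (by omega)).2 (by omega)
    rwa [← e] at h1
  have hws2 : D t ≤ D (w - s - 1) := by
    have h1 := (mA t i (by omega) (by omega)).1
    have e : t + i * (N + 1) = w - s - 1 := by omega
    rwa [e] at h1
  have hE1' : r = N → N ≤ w → D (w - N) - (N - 1) ≤ D (w + r) := by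
    intro h h'
    have h1 := hE1 (w - N)
    have e : w - N + 2 * N = w + r := by omega
    rwa [e] at h1
  have hE2' : r + 1 = N → N ≤ w → B (w - 1) ∨ D (w - N) - (N - 1) + lam ≤ D (w + r) := by
    intro h h'
    have h1 := hE2 (w - N)
    have e : w - N + 2 * N - 1 = w + r := by omega
    have e2 : w - N + N - 1 = w - 1 := by omega
    rwa [e, e2] at h1
  have hw11 : 1 ≤ s → D (t + 1) - (s - 1) * lam ≤ D (w - 1) := by
    intro h
    have h1 := hD (w - s) (s - 1)
    have e : w - s + (s - 1) = w - 1 := by omega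
    rw [e] at h1
    push_cast [h] at h1
    linarith
  have key : (0:ℝ) ≤ (N - 1) * (lam - 1) := hσ ▸ hσ0
  have hsmall : ∀ a : ℕ, ∀ b : ℕ, a ≤ b → (a:ℝ) * lam ≤ b * lam := by
    intro a b hab
    have : (a : ℝ) ≤ b := by exact_mod_cast hab
    exact mul_le_mul_of_nonneg_right this (by linarith)
  rcases hS with hG | ⟨hS1, hS2⟩
  · -- state G
    rcases Nat.lt_or_ge s N with hsN | hsN
    · by_cases hsr : s + r + 2 ≤ 2 * N
      · left
        have h1 := hP1 _ hwr
        have h2 := hsmall _ _ hsr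
        push_cast at h2
        linarith
      · right
        have hs' : (s:ℝ) = N - 1 := by
          have : s + 1 = N := by omega
          rw [← this]; push_cast; ring
        have hr' : r = N := by omega
        have h1 := hP1 _ hwr
        have h2 := hQN hr'
        have hr'' : (r:ℝ) = N := by exact_mod_cast hr'
        rw [hs'] at hw1
        rw [hr''] at h1
        constructor <;> linarith
    · have hsN' : s = N := by omega
      have hs' : (s:ℝ) = N := by exact_mod_cast hsN'
      have hwN : N ≤ w := by omega
      rw [hsN'] at hws
      rw [hs'] at hw1 hw11
      by_cases hr2 : r + 2 ≤ N
      · left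
        have h1 := hP1 _ hwr
        have h2 := hsmall _ _ hr2
        push_cast at h2
        linarith
      · by_cases hr1 : r + 1 = N
        · have hr' : (r:ℝ) = N - 1 := by rw [← hr1]; push_cast; ring
          rcases hE2' hr1 hwN with hb | he
          · right
            have h1 := hP1 _ hwr
            rw [hr'] at h1
            have h2 := hQN1 hr1 hb
            have h3 := hw11 (by omega)
            constructor <;> linarith
          · left
            have h1 := hP1 _ he
            linarith
        · left
          have h1 := hP1 _ (hE1' (by omega) hwN)
          linarith
  · rcases Nat.lt_or_ge s N with hsN | hsN
    · by_cases hsr : s + r + 3 ≤ 2 * N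
      · left
        have h1 := hP1 _ hwr
        have h2 := hsmall _ _ hsr
        push_cast at h2
        linarith
      · by_cases hs1 : s + 1 = N
        · have hs' : (s:ℝ) = N - 1 := by rw [← hs1]; push_cast; ring
          have hwN : N ≤ w := by omega
          have ew : w - s - 1 = w - N := by omega
          rw [ew] at hws2
          rw [hs'] at hw1
          by_cases hr1 : r + 1 = N
          · have hr' : (r:ℝ) = N - 1 := by rw [← hr1]; push_cast; ring
            rcases hE2' hr1 hwN with hb | he
            · right
              have h1 := hP1 _ hwr
              rw [hr'] at h1
              have h2 := hQN1 hr1 hb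
              refine ⟨by linarith, ?_⟩
              rcases Nat.eq_zero_or_pos s with h0 | h0
              · have hN1 : N = 1 := by omega
                rw [hN1] at hws2
                linarith
              · have h3 := hw11 h0
                rw [hs'] at h3
                linarith
            · left
              have h1 := hP1 _ he
              linarith
          · left
            have h1 := hP1 _ (hE1' (by omega) hwN)
            linarith
        · have hs' : (s:ℝ) = N - 2 := by
            have : s + 2 = N := by omega
            rw [← this]; push_cast; ring
          have hr' : r = N := by omega
          have hr'' : (r:ℝ) = N := by exact_mod_cast hr'
          right
          have h1 := hP1 _ hwr
          have h2 := hQN hr'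
          rw [hs'] at hw1
          rw [hr''] at h1
          constructor <;> linarith
    · have hsN' : s = N := by omega
      have h0 := hw2 hsN'
      have h1 := hP1 _ hwr
      by_cases hr1 : r + 1 ≤ N
      · left
        have h2 := hsmall _ _ hr1
        push_cast at h2
        linarith
      · right
        have hr' : r = N := by omega
        have hr'' : (r:ℝ) = N := by exact_mod_cast hr'
        have h2 := hQN hr'
        rw [hr''] at h1
        constructor <;> linarith

theorem aux_all (N : ℕ) (hN : 1 ≤ N) (lam : ℝ) (hlam : 1 ≤ lam)
    (D : ℕ → ℝ) (A B : ℕ → Prop) (σ : ℝ) (hσ : σ = ((N : ℝ) - 1) * (lam - 1))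
    (hD : ∀ p r : ℕ, D p - r * lam ≤ D (p + r))
    (hA : ∀ x, A (x + N) → D x + σ ≤ D (x + N + 1))
    (hB : ∀ x, B x → D x + σ ≤ D (x + N + 1))
    (hBA : ∀ x, B x → A (x + 1) → D x + (2 * N - 2) * lam ≤ D (x + 2))
    (hE1 : ∀ x, D x - (N - 1) ≤ D (x + 2 * N))
    (hE2 : ∀ x, B (x + N - 1) ∨ D x - (N - 1) + lam ≤ D (x + 2 * N - 1))
    (hAB : ∀ k, A k ∨ B k)
    (hAi : ∀ k, ∃ l, k < l ∧ A l) (hBi : ∀ k, ∃ l, k < l ∧ B l) (p : ℕ) :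
    D 0 - (3 * N + 2) * lam ≤ D p := by
  classical
  have hNr : (1 : ℝ) ≤ N := by exact_mod_cast hN
  have hσ0 : 0 ≤ σ := by rw [hσ]; exact mul_nonneg (by linarith) (by linarith)
  have hnl : (0:ℝ) ≤ N * lam := by positivity
  have hex : ∃ l, A l := (hAi 0).imp fun _ h => h.2
  obtain ⟨t0, hAt0, hmin⟩ : ∃ t0, A t0 ∧ ∀ y, y < t0 → B y :=
    ⟨Nat.find hex, Nat.find_spec hex, fun y h => (hAB y).resolve_left (Nat.find_min hex h)⟩
  have hinit : ∀ p, p ≤ t0 → D 0 - N * lam ≤ D p := by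
    intro p hp
    have hz := Nat.div_add_mod p (N + 1)
    have hr := Nat.mod_lt p (Nat.succ_pos N)
    set q := p / (N + 1)
    set r := p % (N + 1)
    rw [mul_comm] at hz
    have h1 := (aux_mult D σ hσ0 (N + 1) 0 q (by
      intro i hi
      have : (i + 1) * (N + 1) ≤ q * (N + 1) := Nat.mul_le_mul_right _ hi
      have e : (i + 1) * (N + 1) = i * (N + 1) + (N + 1) := by ring
      exact hB _ (hmin _ (by omega)))).1
    have h3 := hD (0 + q * (N + 1)) r
    have e : 0 + q * (N + 1) + r = p := by omega
    rw [e] at h3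
    have : (r : ℝ) ≤ N := by exact_mod_cast (by omega : r ≤ N)
    have := mul_le_mul_of_nonneg_right this (by linarith : (0:ℝ) ≤ lam)
    linarith
  set κ := D 0 - (N + 1) * lam with hκ
  have hmain : ∀ n : ℕ, ∃ t, n ≤ t ∧ A t ∧
      (κ ≤ D (t + 1) ∨ (κ - lam ≤ D (t + 1) ∧ κ - (N - 1) ≤ D t)) ∧
      ∀ p, p ≤ t → κ - (2 * N + 1) * lam ≤ D p := by
    intro n
    induction n with
    | zero =>
      refine ⟨t0, Nat.zero_le _, hAt0, Or.inl ?_, ?_⟩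
      · have h1 := hinit t0 le_rfl
        have h2 := hD t0 1
        push_cast at h2
        linarith
      · intro p hp
        have := hinit p hp
        linarith
    | succ n ih =>
      obtain ⟨t, hnt, hAt, hS, hp⟩ := ih
      obtain ⟨t', h1, h2, h3, h4⟩ := aux_step N hN lam hlam D A B σ hσ hD hA hB hBA hE1 hE2 hAB hAi hBi κ t hAt hS
      refine ⟨t', by omega, h2, h3, ?_⟩
      intro p hp'
      rcases Nat.lt_or_ge t p with h | h
      · exact h4 p h hp'
      · exact hp p h
  obtain ⟨t, h1, _, _, h4⟩ := hmain p
  have := h4 p h1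
  linarith

/-- sequence version -/
theorem aux_seq (N L : ℕ) (hN : 1 ≤ N) (h2 : 2 * N < L) (b m : ℕ → ℕ) (hb : StrictMono b)
    (hbm : ∀ k, b k ≤ m k) (hmb : ∀ k, m k ≤ b k + L)
    (hAB : ∀ k, m k < b (k + 1) ∨ b k + L < m (k + 1))
    (hW : ∀ k s, s ≤ N → N ≤ k + s → m k < b (k + s) ∨ b (k + s - N) + L < m k)
    (hAi : ∀ k, ∃ l, k < l ∧ m l < b (l + 1)) (hBi : ∀ k, ∃ l, k < l ∧ b l + L < m (l + 1))
    (p : ℕ) :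
    (p : ℝ) * (1 + (L : ℝ) / (2 * N)) ≤ b p + (3 * N + 2) * ((L : ℝ) / (2 * N)) := by
  have hNr : (1 : ℝ) ≤ N := by exact_mod_cast hN
  set lam : ℝ := (L : ℝ) / (2 * N) with hlam
  have hL : (L : ℝ) = 2 * N * lam := by rw [hlam]; field_simp
  have hlam1 : 1 ≤ lam := by
    rw [hlam, le_div_iff₀ (by linarith)]
    have : ((2 * N : ℕ) : ℝ) ≤ L := by exact_mod_cast h2.le
    push_cast at this; linarith
  set D : ℕ → ℝ := fun p => b p - p - lam * p with hDdef
  set σ : ℝ := ((N : ℝ) - 1) * (lam - 1) with hσ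
  have hD : ∀ p r : ℕ, D p - r * lam ≤ D (p + r) := by
    intro p r
    have h1 : b p + r ≤ b (p + r) := by
      induction r with
      | zero => simp
      | succ r ih => 
        have h0 : b (p + r) < b (p + (r + 1)) := hb (by omega)
        omega
    have h1' : (b p : ℝ) + r ≤ b (p + r) := by exact_mod_cast h1
    simp only [hDdef]; push_cast; linarith
  have hwin : ∀ x, b x + L + 2 ≤ b (x + N + 1) → D x + σ ≤ D (x + N + 1) := by
    intro x h
    have h' : (b x : ℝ) + L + 2 ≤ b (x + N + 1) := by exact_mod_cast h
    simp only [hDdef]; push_cast; rw [hL] at h'; rw [hσ]; linarith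
  have hE : ∀ x, ∃ c, c + 1 ≤ N ∧ b (x + c) + L < m (x + N) ∧ D (x + c) + σ ≤ D (x + c + N + 1) := by
    intro x
    have hex : ∃ s, m (x + N) < b (x + N + s) := by
      refine ⟨N, (hW (x + N) N le_rfl (by omega)).resolve_right ?_⟩
      have := hmb (x + N)
      rw [Nat.add_sub_cancel]; omega
    obtain ⟨s, hs, hmin⟩ : ∃ s, m (x + N) < b (x + N + s) ∧ ∀ y, y < s → ¬ m (x + N) < b (x + N + y) :=
      ⟨Nat.find hex, Nat.find_spec hex, fun y h => Nat.find_min hex h⟩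
    have hs0 : s ≠ 0 := by
      rintro rfl
      have := hbm (x + N)
      rw [Nat.add_zero] at hs; omega
    have hsN : s ≤ N := by
      by_contra hcon
      have := hmin N (by omega)
      have h3 := (hW (x + N) N le_rfl (by omega)).resolve_left this
      have := hmb (x + N)
      rw [Nat.add_sub_cancel] at h3; omega
    have h3 := (hW (x + N) (s - 1) (by omega) (by omega)).resolve_left (hmin _ (by omega))
    have e : x + N + (s - 1) - N = x + (s - 1) := by omega
    rw [e] at h3
    refine ⟨s - 1, by omega, h3, hwin _ ?_⟩
    have e2 : x + (s - 1) + N + 1 = x + N + s := by omega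
    rw [e2]; omega
  have := aux_all N hN lam hlam1 D (fun k => m k < b (k + 1)) (fun k => b k + L < m (k + 1)) σ hσ hD
    (by
      intro x hx
      apply hwin
      have h1 := hbm (x + N)
      have h3 := (hW (x + N) 0 (by omega) (by omega)).resolve_left (by rw [Nat.add_zero]; omega)
      rw [Nat.add_zero, Nat.add_sub_cancel] at h3
      omega)
    (by
      intro x hx
      apply hwin
      have h1 := hmb (x + 1)
      have h3 := (hW (x + 1) N le_rfl (by omega)).resolve_right (by rw [Nat.add_sub_cancel]; omega)
      have e : x + 1 + N = x + N + 1 := by omega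
      rw [e] at h3
      omega)
    (by
      intro x hx hy
      have h : b x + L + 2 ≤ b (x + 2) := by
        have e : x + 1 + 1 = x + 2 := rfl
        rw [e] at hy; omega
      have h' : (b x : ℝ) + L + 2 ≤ b (x + 2) := by exact_mod_cast h
      simp only [hDdef]; push_cast; rw [hL] at h'; linarith)
    (by
      intro x
      obtain ⟨c, hc, -, h⟩ := hE x
      have h1 := hD x c
      have h3 := hD (x + c + N + 1) (N - (c + 1))
      have e : x + c + N + 1 + (N - (c + 1)) = x + 2 * N := by omega
      rw [e] at h3
      push_cast [hc] at h3
      rw [hσ] at h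
      linarith)
    (by
      intro x
      obtain ⟨c, hc, hcm, h⟩ := hE x
      by_cases hcN : c + 1 = N
      · left
        have e : x + N - 1 = x + c := by omega
        have e2 : x + c + 1 = x + N := by omega
        simp only [e, e2]; exact hcm
      · right
        have hc2 : c + 2 ≤ N := by omega
        have h1 := hD x c
        have h3 := hD (x + c + N + 1) (N - (c + 2))
        have e : x + c + N + 1 + (N - (c + 2)) = x + 2 * N - 1 := by omega
        rw [e] at h3
        push_cast [hc2] at h3
        rw [hσ] at h
        linarith)
    hAB hAi hBi p
  simp only [hDdef] at this
  have hb0 : (0:ℝ) ≤ b 0 := by positivity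
  push_cast at this
  linarith

/-- Enumerate the decoding pairs and extend by isolated phantom pairs. -/
theorem aux_scheme (L Nc K : ℕ) (hNc : 1 ≤ Nc) (h2 : 2 * Nc < L) (C : ℕ → Finset ℕ)
    (hC : IsCellAssoc K Nc C) (S : UplinkScheme K L C) :
    ((S.D.card : ℝ) - 1) * (1 + (L : ℝ) / (2 * Nc)) ≤ K + (3 * Nc + 2) * ((L : ℝ) / (2 * Nc)) := by
  classical
  have hR : (0 : ℝ) ≤ (L : ℝ) / (2 * Nc) := by positivity
  rcases Nat.eq_zero_or_pos S.D.card with h0 | hpos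
  · rw [h0]
    have h3 : (0 : ℝ) ≤ K + (3 * Nc + 2) * ((L : ℝ) / (2 * Nc)) := by positivity
    push_cast
    linarith
  set n := S.D.card with hn
  have hcard : (S.D.image Prod.snd).card = n := by
    rw [hn]
    apply Finset.card_image_of_injOn
    intro p hp q hq hpq
    by_contra hne
    exact (S.distinct p hp q hq hne).2 hpq
  set e := (S.D.image Prod.snd).orderEmbOfFin hcard with he
  have hex : ∀ k : Fin n, ∃ i, (i, e k) ∈ S.D := by
    intro k
    have h := (S.D.image Prod.snd).orderEmbOfFin_mem hcard k
    rw [Finset.mem_image] at h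
    obtain ⟨q, hq, hqe⟩ := h
    exact ⟨q.1, by rw [he, ← hqe]; exact hq⟩
  choose f hf using hex
  let b : ℕ → ℕ := fun k => if h : k < n then e ⟨k, h⟩ else (K + L + 1) * (k + 1)
  let m : ℕ → ℕ := fun k => if h : k < n then f ⟨k, h⟩ else (K + L + 1) * (k + 1)
  have hbr : ∀ k (h : k < n), b k = e ⟨k, h⟩ := fun k h => dif_pos h
  have hmr : ∀ k (h : k < n), m k = f ⟨k, h⟩ := fun k h => dif_pos h
  have hbp : ∀ k, n ≤ k → b k = (K + L + 1) * (k + 1) := fun k h => dif_neg (by omega)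
  have hmp : ∀ k, n ≤ k → m k = (K + L + 1) * (k + 1) := fun k h => dif_neg (by omega)
  have hmem : ∀ k, k < n → (m k, b k) ∈ S.D := by
    intro k h
    rw [hbr k h, hmr k h]; exact hf _
  have hbK : ∀ k, k < n → b k ≤ K := fun k h =>
    (Finset.mem_Icc.mp (S.mem_range _ (hmem k h)).2).2
  have hmK : ∀ k, k < n → m k ≤ K := fun k h =>
    (Finset.mem_Icc.mp (S.mem_range _ (hmem k h)).1).2
  have hbig : ∀ k, n ≤ k → K + L + 1 ≤ b k := by
    intro k h
    rw [hbp k h]; exact Nat.le_mul_of_pos_right _ (by omega)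
  have hgap : ∀ k, n ≤ k + 1 → b k + L + 1 ≤ b (k + 1) := by
    intro k h
    rcases Nat.lt_or_ge k n with h' | h'
    · have h1 := hbK k h'
      have h3 := hbig (k + 1) h
      omega
    · rw [hbp k h', hbp (k + 1) h]
      have : (K + L + 1) * (k + 1 + 1) = (K + L + 1) * (k + 1) + (K + L + 1) := by ring
      omega
  have hb : StrictMono b := by
    apply strictMono_nat_of_lt_succ
    intro k
    rcases Nat.lt_or_ge (k + 1) n with h | h
    · rw [hbr k (by omega), hbr (k + 1) h]
      exact e.strictMono (by simp [Fin.lt_def])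
    · have := hgap k h
      omega
  have hbm : ∀ k, b k ≤ m k := by
    intro k
    rcases Nat.lt_or_ge k n with h | h
    · exact (S.conn _ (hmem k h)).2
    · rw [hbp k h, hmp k h]
  have hmb : ∀ k, m k ≤ b k + L := by
    intro k
    rcases Nat.lt_or_ge k n with h | h
    · have := (S.conn _ (hmem k h)).1
      simp only at this
      omega
    · rw [hbp k h, hmp k h]; omega
  have hmlt : ∀ k, n ≤ k + 1 → m k < b (k + 1) := by
    intro k h
    rcases Nat.lt_or_ge k n with h' | h'
    · have := hmK k h'
      have := hbig (k + 1) h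
      omega
    · have := hgap k h
      have := hbp k h'
      have := hmp k h'
      omega
  have hmain := aux_seq Nc L hNc h2 b m hb hbm hmb
    (by
      intro k
      rcases Nat.lt_or_ge (k + 1) n with h | h
      · by_contra hcon
        push Not at hcon
        obtain ⟨hc1, hc2⟩ := hcon
        have hk := hmem k (by omega)
        have hk1 := hmem (k + 1) h
        have hlt : b k < b (k + 1) := hb (by omega)
        have hne : (m k, b k) ≠ (m (k + 1), b (k + 1)) := by
          intro h
          have := (Prod.mk.inj h).2
          omega
        have hd := (S.distinct _ hk _ hk1 hne).1
        have hm1 := hmb k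
        have hm2 := hbm (k + 1)
        have z1 := (S.zf _ hk _ hk1 hd ⟨by simp only; omega, hc1⟩).2
        have z2 := (S.zf _ hk1 _ hk hd.symm ⟨by simp only; omega, by simp only; omega⟩).2
        exact S.lt_irrefl _ hk (S.lt_trans _ hk _ hk1 _ hk z1 z2)
      · exact Or.inl (hmlt k h))
    (by
      intro k s hs hks
      rcases Nat.lt_or_ge k n with hk | hk
      · rcases Nat.lt_or_ge (k + s) n with h | h
        · by_contra hcon
          push Not at hcon
          obtain ⟨hc1, hc2⟩ := hcon
          have hsub : (Finset.Icc (k + s - Nc) (k + s)).image b ⊆ C (m k) := by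
            intro y hy
            rw [Finset.mem_image] at hy
            obtain ⟨j, hj, rfl⟩ := hy
            rw [Finset.mem_Icc] at hj
            have hjm := hmem j (by omega)
            by_cases hjk : m k = m j
            · have := S.assoc _ hjm
              simp only at this
              rw [hjk]; exact this
            · have h5 : b (k + s - Nc) ≤ b j := hb.monotone hj.1
              have h6 : b j ≤ b (k + s) := hb.monotone hj.2
              exact (S.zf _ (hmem k hk) _ hjm hjk
                ⟨by simp only; omega, by simp only; omega⟩).1
          have hcle := Finset.card_le_card hsub
          rw [Finset.card_image_of_injective _ hb.injective, Nat.card_Icc] at hcle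
          have := (hC (m k) (S.mem_range _ (hmem k hk)).1).2
          omega
        · left
          have := hmK k hk
          have := hbig (k + s) h
          omega
      · rcases Nat.eq_zero_or_pos s with h0 | h0
        · right
          subst h0
          obtain ⟨l, rfl⟩ : ∃ l, k = l + 1 := ⟨k - 1, by omega⟩
          have h5 : b (l + 1 + 0 - Nc) ≤ b l := hb.monotone (by omega)
          have := hgap l hk
          have := hbm (l + 1)
          omega
        · left
          have h5 : b (k + 1) ≤ b (k + s) := hb.monotone (by omega)
          have := hmlt k (by omega)
          omega)
    (by
      intro k
      exact ⟨k + n + 1, by omega, hmlt _ (by omega)⟩)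
    (by
      intro k
      refine ⟨k + n + 1, by omega, ?_⟩
      have := hgap (k + n + 1) (by omega)
      have := hbm (k + n + 1 + 1)
      omega)
    (n - 1)
  have hfin : (b (n - 1) : ℝ) ≤ K := by exact_mod_cast hbK (n - 1) (by omega)
  have hcast : ((n - 1 : ℕ) : ℝ) = (n : ℝ) - 1 := by
    push_cast [Nat.cast_sub (show 1 ≤ n from hpos)]; ring
  rw [hcast] at hmain
  linarith

/-- Converse part of Theorem 1 for `Nc < L/2`: the asymptotic uplink zero-forcing
per-user DoF is at most `2Nc/(2Nc+L)`. -/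
theorem uplink_low_range_converse (L Nc : ℕ) (hL : 0 < L) (hNc : 1 ≤ Nc)
    (h2 : 2 * Nc < L) :
    ∀ ε : ℝ, 0 < ε → ∃ K₀ : ℕ, ∀ K : ℕ, K₀ ≤ K →
      ∀ C : ℕ → Finset ℕ, IsCellAssoc K Nc C →
        ∀ S : UplinkScheme K L C,
          (S.D.card : ℝ) ≤ ((2 * (Nc : ℝ)) / (2 * (Nc : ℝ) + (L : ℝ)) + ε) * (K : ℝ) := by
  intro ε hε
  have hNr : (1 : ℝ) ≤ Nc := by exact_mod_cast hNc
  have hLr : (0 : ℝ) < L := by exact_mod_cast hL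
  set lam : ℝ := (L : ℝ) / (2 * Nc) with hlam
  have hlam0 : 0 < lam := by positivity
  obtain ⟨K₀, hK₀⟩ := exists_nat_gt ((1 + (3 * Nc + 2) * lam) / ε)
  refine ⟨K₀, fun K hK C hC S => ?_⟩
  have h1 := aux_scheme L Nc K hNc h2 C hC S
  rw [← hlam] at h1
  have hr : (2 * (Nc : ℝ)) / (2 * (Nc : ℝ) + (L : ℝ)) = 1 / (1 + lam) := by
    rw [hlam]; field_simp
  rw [hr]
  have hKr : (K₀ : ℝ) ≤ K := by exact_mod_cast hK
  have h3 : 1 + (3 * Nc + 2) * lam ≤ ε * K := by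
    have : (1 + (3 * Nc + 2) * lam) / ε ≤ K := by linarith
    rw [div_le_iff₀ hε] at this
    linarith
  have hX : (0 : ℝ) ≤ (3 * Nc + 2) * lam := by positivity
  have h4 : (S.D.card : ℝ) - 1 ≤ (K + (3 * Nc + 2) * lam) / (1 + lam) := by
    rw [le_div_iff₀ (by linarith)]; exact h1
  have h5 : (3 * Nc + 2) * lam / (1 + lam) ≤ (3 * Nc + 2) * lam :=
    div_le_self hX (by linarith)
  have h6 : (K + (3 * Nc + 2) * lam) / (1 + lam) = 1 / (1 + lam) * K + (3 * Nc + 2) * lam / (1 + lam) := by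
    ring
  rw [h6] at h4
  linarith
end

section
/- Suppose 1 ≤ N_c and 2·N_c ≤ L. For every real ε > 0 there exists K₀ such that for every K ≥ K₀, every cell association C_1,…,C_K with |C_i| ≤ N_c, every combinatorial uplink zero-forcing scheme (D, ≺) for it, and every combinatorial downlink zero-forcing scheme with active receiver set A for it: |D| + |A| ≤ (4N_c/(2N_c + L) + ε)·K. (Optimality part of Theorem 2: for N_c ≤ L/2 the average uplink-downlink zero-forcing per-user DoF equals 2N_c/(2N_c + L).) -/
/-- A full coverage cell association: each MT is associated with all BSs connected to it. -/
def FullCoverage (K L : ℕ) (C : ℕ → Finset ℕ) : Prop :=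
  ∀ i ∈ Finset.Icc 1 K, Finset.Icc (max 1 (i - L)) i ⊆ C i

/-- A combinatorial downlink zero-forcing scheme for the association `C`:
a set `A ⊆ {1,…,K}` of active receivers and, for each `i ∈ A`, a nonempty set
`T i ⊆ C i` of base stations actively transmitting `W i`, at least one of which is
connected to receiver `i`, such that there is a matching between `T i` and the set of
active receivers connected to at least one BS in `T i`, saturating those receivers. -/
structure DownlinkScheme (K L : ℕ) (C : ℕ → Finset ℕ) where
  A : Finset ℕ
  T : ℕ → Finset ℕ
  A_sub : A ⊆ Finset.Icc 1 K
  T_sub : ∀ i ∈ A, T i ⊆ C i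
  T_nonempty : ∀ i ∈ A, (T i).Nonempty
  T_conn : ∀ i ∈ A, ∃ j ∈ T i, Connected L i j
  matching : ∀ i ∈ A, ∃ f : ℕ → ℕ,
      (∀ r ∈ A, (∃ j ∈ T i, Connected L r j) → f r ∈ T i ∧ Connected L r (f r)) ∧
      (∀ r ∈ A, ∀ s ∈ A, (∃ j ∈ T i, Connected L r j) → (∃ j ∈ T i, Connected L s j) →
        f r = f s → r = s)


lemma jlr_step (L : ℤ) (q : ℤ → ℤ) (h0 : ∀ v, q v - L ≤ q (v + 1)) (u v : ℤ) (h : v ≤ u) :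
    q v - (u - v) * L ≤ q u := by
  induction u, h using Int.leInduction with
  | base => simp
  | succ u hu ih => have := h0 u; linarith

lemma jlr_upper (L n δ : ℤ) (q : ℤ → ℤ) (h0 : ∀ v, q v - L ≤ q (v + 1)) (hL : 0 ≤ L)
    (hn : 0 < n) (hper : ∀ v, q (v + n) = q v + δ) (hδ : δ < 0) (θ : ℤ) :
    ∃ B, ∀ v, θ ≤ q v → v ≤ B := by
  have hm : ∀ j : ℕ, q (n * j) = q 0 + j * δ := by
    intro j
    induction j with
    | zero => simp
    | succ j ih =>
      have := hper (n * j)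
      push_cast
      rw [show n * ((j : ℤ) + 1) = n * j + n by ring, this, ih]; ring
  refine ⟨n * (|q 0| + n * L + |θ| + 1), fun v hv => ?_⟩
  by_contra hc
  push Not at hc
  have hnn : 0 ≤ n * L := by positivity
  have hv0 : 0 ≤ v := by
    have : 0 ≤ n * (|q 0| + n * L + |θ| + 1) := by positivity
    linarith
  obtain ⟨j, hj⟩ := Int.eq_ofNat_of_zero_le (show 0 ≤ v / n + 1 by positivity)
  have e1 := Int.emod_add_mul_ediv v n
  have e2 := Int.emod_nonneg v hn.ne'
  have e3 := Int.emod_lt_of_pos v hn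
  have hjn : n * (j : ℤ) = n * (v / n) + n := by rw [← hj]; ring
  have h1 := jlr_step L q h0 (n * j) v (by linarith)
  have h2 := hm j
  have h3 : |q 0| + n * L + |θ| + 1 < j := by
    have : n * (|q 0| + n * L + |θ| + 1) < n * j := by linarith
    exact lt_of_mul_lt_mul_left this hn.le
  have h4 : (n * j - v) * L ≤ n * L := by
    apply mul_le_mul_of_nonneg_right _ hL
    linarith
  have h5 : (j : ℤ) * δ ≤ - j := by nlinarith
  have := le_abs_self (q 0)
  have := neg_abs_le θ
  linarith

lemma jlr_chunk (M : ℤ) (q : ℤ → ℤ) (Q : ℤ → Prop)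
    (h3 : ∀ v, Q v → q (v - M) ≤ q (v + 1)) (hM : 1 ≤ M) (p t : ℤ)
    (hQ : ∀ x, 0 ≤ x → x < t → Q (p + x)) (s : ℕ) (x : ℤ) (hx : 0 ≤ x)
    (hs : x + (M + 1) * s ≤ t) : q (p + x) ≤ q (p + x + (M + 1) * s) := by
  induction s with
  | zero => simp
  | succ s ih =>
    push_cast at hs ⊢
    have hp : 0 ≤ (M + 1) * (s : ℤ) := by positivity
    have hs' : x + (M + 1) * (s : ℤ) ≤ t := by linarith
    have := h3 _ (hQ (x + (M + 1) * s + M) (by linarith) (by linarith))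
    rw [show p + (x + (M + 1) * (s : ℤ) + M) - M = p + x + (M + 1) * s by ring,
      show p + (x + (M + 1) * (s : ℤ) + M) + 1 = p + x + (M + 1) * (s + 1) by ring] at this
    exact (ih hs').trans this

/-- the length of the `Q`-run starting at `p`, together with its residue. -/
lemma jlr_run (M : ℤ) (q : ℤ → ℤ) (Q : ℤ → Prop)
    (h3 : ∀ v, Q v → q (v - M) ≤ q (v + 1)) (hM : 1 ≤ M)
    (hbd : ∀ θ, ∃ B, ∀ v, θ ≤ q v → v ≤ B) (p : ℤ) (hp : Q p) :
    ∃ t t' : ℤ, ∃ s : ℕ, 1 ≤ t' ∧ t' ≤ M + 1 ∧ t = t' + (M + 1) * s ∧ ¬ Q (p + t) ∧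
      (∀ y, 0 ≤ y → y ≤ t' → q (p + t' - y) ≤ q (p + t - y)) ∧
      (t' = M + 1 → q p ≤ q (p + t)) := by
  have hex : ∃ x, 0 ≤ x ∧ ¬ Q (p + x) := by
    by_contra hc
    push Not at hc
    obtain ⟨B, hB⟩ := hbd (q p)
    obtain ⟨v, ⟨hv1, hv2⟩, hv3⟩ := Int.exists_greatest_of_bdd (P := fun v => p ≤ v ∧ q p ≤ q v)
      ⟨B, fun z hz => hB z hz.2⟩ ⟨p, le_rfl, le_rfl⟩
    have h := h3 (v + M) (by have := hc (v + M - p) (by linarith); rwa [add_sub_cancel] at this)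
    rw [add_sub_cancel_right] at h
    have := hv3 (v + M + 1) ⟨by linarith, by linarith⟩
    linarith
  obtain ⟨t, ⟨ht1, ht2⟩, ht3⟩ := Int.exists_least_of_bdd (P := fun x => 0 ≤ x ∧ ¬ Q (p + x))
      ⟨0, fun z hz => hz.1⟩ hex
  have ht0 : t ≠ 0 := by rintro rfl; simp [hp] at ht2
  have hrun : ∀ x, 0 ≤ x → x < t → Q (p + x) := by
    intro x hx hxt
    by_contra hc
    have := ht3 x ⟨hx, hc⟩
    linarith
  obtain ⟨s, hs⟩ := Int.eq_ofNat_of_zero_le (show 0 ≤ (t - 1) / (M + 1) from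
    Int.ediv_nonneg (by omega) (by omega))
  have e1 := Int.emod_add_mul_ediv (t - 1) (M + 1)
  have e2 := Int.emod_nonneg (t - 1) (show M + 1 ≠ 0 by omega)
  have e3 := Int.emod_lt_of_pos (t - 1) (show 0 < M + 1 by omega)
  rw [hs] at e1
  refine ⟨t, (t - 1) % (M + 1) + 1, s, by omega, by omega, by linarith, ht2, ?_, ?_⟩
  swap
  · intro hm
    have := jlr_chunk M q Q h3 hM p t hrun (s + 1) 0 le_rfl (by push_cast; linarith)
    rw [add_zero, show p + (M + 1) * ((s + 1 : ℕ) : ℤ) = p + t by push_cast; linarith] at this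
    exact this
  intro y hy hyt
  have := jlr_chunk M q Q h3 hM p t hrun s ((t - 1) % (M + 1) + 1 - y) (by linarith) (by linarith)
  rw [show p + ((t - 1) % (M + 1) + 1 - y) = p + ((t - 1) % (M + 1) + 1) - y by ring,
    show p + ((t - 1) % (M + 1) + 1) - y + (M + 1) * (s : ℤ) = p + t - y by linarith] at this
  exact this

lemma jlr_core (M L n δ : ℤ) (q : ℤ → ℤ) (R Q : ℤ → Prop)
    (hM : 1 ≤ M) (hL : 0 ≤ L) (hn : 0 < n)
    (hper : ∀ v, q (v + n) = q v + δ)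
    (h0 : ∀ v, q v - L ≤ q (v + 1))
    (h1 : ∀ v, R v ∨ Q v)
    (h2 : ∀ v, R v → q v ≤ q (v + M + 1))
    (h3 : ∀ v, Q v → q (v - M) ≤ q (v + 1))
    (h4 : ∀ v, R (v - 1) → Q v → q (v - 1) + 2 * (M - 1) * L ≤ q (v + 1))
    (h5 : ∀ v, ¬ R (v - 1) → ¬ Q v → ∃ a, v + 1 - M ≤ a ∧ a ≤ v - 2 ∧ q a ≤ q (a + M + 1)) :
    0 ≤ δ := by
  by_contra hδ
  push Not at hδ
  have hbd := jlr_upper L n δ q h0 hL hn hper hδ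
  have hst := jlr_step L q h0
  -- some edge is labelled `R`
  have hR : ∃ v, R v := by
    by_contra hc
    push Not at hc
    obtain ⟨t, t', s, -, -, -, h, -, -⟩ := jlr_run M q Q h3 hM hbd 0 ((h1 0).resolve_left (hc 0))
    exact h ((h1 _).resolve_left (hc _))
  obtain ⟨v0, hv0⟩ := hR
  obtain ⟨B, hB⟩ := hbd (q v0)
  obtain ⟨v, ⟨hv1, hv2⟩, hv3⟩ := Int.exists_greatest_of_bdd
    (P := fun v => R v ∧ q v0 ≤ q v) ⟨B, fun z hz => hB z hz.2⟩ ⟨v0, hv0, le_rfl⟩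
  set θ := q v0 with hθ
  have hfin : ∀ u, v < u → θ ≤ q u → ¬ R u := by
    intro u hu hq hRu
    have := hv3 u ⟨hRu, hq⟩
    linarith
  have hvM := h2 v hv1
  have hnR := hfin (v + M + 1) (by linarith) (by linarith)
  obtain ⟨r, ⟨hr1, hr2⟩, hr3⟩ := Int.exists_least_of_bdd (P := fun x => 1 ≤ x ∧ ¬ R (v + x))
      ⟨1, fun z hz => hz.1⟩ ⟨M + 1, by linarith, by rwa [← add_assoc]⟩
  have hrM : r ≤ M + 1 := hr3 (M + 1) ⟨by linarith, by rwa [← add_assoc]⟩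
  have hRr : R (v + r - 1) := by
    by_cases hr : r = 1
    · subst hr; simpa using hv1
    · by_contra hc
      have := hr3 (r - 1) ⟨by omega, by rwa [← add_sub_assoc]⟩
      linarith
  have hQr : Q (v + r) := (h1 _).resolve_left hr2
  have hp1 := h4 _ hRr hQr
  have hp0 := hst (v + r - 1) v (by linarith)
  obtain ⟨t, t', s, ht1, ht2, ht3, ht4, ht5, ht6⟩ := jlr_run M q Q h3 hM hbd (v + r) hQr
  have hRt : R (v + r + t) := (h1 _).resolve_right ht4
  have hs0 : 0 ≤ (M + 1) * (s : ℤ) := by positivity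
  have hlow : ∀ x, 1 ≤ x → θ + (2 * M - r - x) * L ≤ q (v + r + x) := by
    intro x hx
    have := hst (v + r + x) (v + r + 1) (by linarith)
    linarith
  have hneg : q (v + r + t) < θ := by
    by_contra hc
    push Not at hc
    exact hfin _ (by linarith) hc hRt
  have hrt : 2 * M < r + t' := by
    by_contra hc
    push Not at hc
    have a1 := hlow t' ht1
    have a2 := ht5 0 le_rfl (by linarith)
    have a3 : 0 ≤ (2 * M - r - t') * L := mul_nonneg (by linarith) hL
    simp only [sub_zero] at a2
    linarith
  have hrt2 : r + t' = 2 * M + 1 := by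
    by_contra hc
    have e1 : r = M + 1 := by omega
    have e2 : t' = M + 1 := by omega
    have a2 := ht6 e2
    rw [e1, ← add_assoc] at a2
    rw [e1, ← add_assoc] at hneg
    linarith
  -- the vertex just before the end of the run is still high
  have hprev : θ ≤ q (v + r + t - 1) := by
    have a2 := ht5 1 (by norm_num) ht1
    rcases eq_or_lt_of_le ht1 with h | h
    · have e1 : M = 1 := by omega
      have e2 : r = M + 1 := by omega
      rw [← h, e2, ← add_assoc] at a2
      rw [e2, ← add_assoc]
      simp only [add_sub_cancel_right] at a2
      linarith
    · have a1 := hlow (t' - 1) (by omega)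
      rw [show 2 * M - r - (t' - 1) = 0 by linarith, ← add_sub_assoc] at a1
      linarith
  have hnR' := hfin (v + r + t - 1) (by linarith) hprev
  obtain ⟨a, ha1, ha2, ha3⟩ := h5 _ hnR' ht4
  obtain ⟨y, rfl⟩ : ∃ y, a = v + r + t - y := ⟨v + r + t - a, by ring⟩
  have hqa : θ + L ≤ q (v + r + t - y) := by
    have b1 := ht5 y (by linarith) (by omega)
    have b2 := hlow (t' - y) (by omega)
    rw [← add_sub_assoc] at b2
    have b3 : 1 * L ≤ (2 * M - r - (t' - y)) * L :=
      mul_le_mul_of_nonneg_right (by linarith) hL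
    linarith
  set a := v + r + t - y with ha
  set w := a + M + 1 with hw
  have hnw := hfin w (by linarith) (by linarith)
  obtain ⟨z, ⟨hz1, hz2⟩, hz3⟩ := Int.exists_least_of_bdd
    (P := fun x => v + r + t < x ∧ ¬ R x) ⟨v + r + t, fun z hz => hz.1.le⟩ ⟨w, by linarith, hnw⟩
  have hzw : z ≤ w := hz3 w ⟨by linarith, hnw⟩
  have hRz : R (z - 1) := by
    by_cases h : z - 1 = v + r + t
    · rw [h]; exact hRt
    · by_contra hc
      have := hz3 (z - 1) ⟨by omega, hc⟩
      linarith
  have hQz := (h1 z).resolve_left hz2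
  have c1 := h4 z hRz hQz
  have c2 := hst (z - 1) a (by linarith)
  have c3 := hst (w + 1) (z + 1) (by linarith)
  have c4 : θ + (M - 1) * L ≤ q (w + 1) := by
    have : w - a = M + 1 := by rw [hw]; ring
    have : (z - 1 - a) * L + (w + 1 - (z + 1)) * L = M * L := by
      rw [← add_mul]; congr 1; linarith
    linarith
  obtain ⟨t2, t2', s2, k1, k2, k3, k4, k5, k6⟩ :=
    jlr_run M q Q h3 hM hbd w ((h1 w).resolve_left hnw)
  have hs2 : 0 ≤ (M + 1) * (s2 : ℤ) := by positivity
  refine hfin (w + t2) (by linarith) ?_ ((h1 _).resolve_right k4)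
  by_cases hk : t2' = M + 1
  · have := k6 hk
    linarith
  · have d1 := k5 0 le_rfl (by linarith)
    simp only [sub_zero] at d1
    have d2 := hst (w + t2') (w + 1) (by linarith)
    have d3 : (w + t2' - (w + 1)) * L ≤ (M - 1) * L :=
      mul_le_mul_of_nonneg_right (by omega) hL
    linarith

lemma jlr_gap (b : ℤ → ℤ) (hb : ∀ k, b k + 1 ≤ b (k + 1)) (u v : ℤ) (h : v ≤ u) :
    b v + (u - v) ≤ b u := by
  induction u, h using Int.leInduction with
  | base => simp
  | succ u hu ih => have := hb u; linarith

/-- Uplink sequences: `b` the base stations, `i` the terminals decoded there. -/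
lemma jlr_uplink_seq (M L n P : ℤ) (b i : ℤ → ℤ) (hM : 1 ≤ M) (hL : 2 * M ≤ L) (hn : 0 < n)
    (hper : ∀ k, b (k + n) = b k + P)
    (hb : ∀ k, b k + 1 ≤ b (k + 1))
    (hi1 : ∀ k, b k ≤ i k) (hi2 : ∀ k, i k ≤ b k + L)
    (hac : ∀ k, i k < b (k + 1) ∨ b k + L < i (k + 1))
    (hw : ∀ k a, i k - L ≤ b a → i k < b (a + M)) :
    (2 * M + L) * n ≤ 2 * M * P := by
  have hg := jlr_gap b hb
  have key := jlr_core M L n (2 * M * P - (2 * M + L) * n)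
    (fun k => 2 * M * b k - (2 * M + L) * k)
    (fun k => b k < i (k + 1) - L) (fun k => i k < b (k + 1)) hM (by linarith) hn ?_ ?_ ?_ ?_ ?_ ?_ ?_
  · linarith
  · intro v; simp only [hper]; ring
  · intro v
    have := mul_le_mul_of_nonneg_left (hb v) (show 0 ≤ 2 * M by linarith)
    linarith
  · intro v
    rcases hac v with h | h
    · exact Or.inr h
    · left; linarith
  · intro v hv

    have h1 := hw (v + 1) (v + 1) (by linarith [hi2 (v + 1)])
    rw [show v + 1 + M = v + M + 1 by ring] at h1
    have h2 : b v + (L + 2) ≤ b (v + M + 1) := by linarith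
    have := mul_le_mul_of_nonneg_left h2 (show 0 ≤ 2 * M by linarith)
    have : 0 ≤ (M - 1) * (L - 2 * M) := mul_nonneg (by linarith) (by linarith)
    linarith
  · intro v hv

    have h1 : b (v - M) < i v - L := by
      by_contra hc
      push Not at hc
      have := hw v (v - M) hc
      rw [sub_add_cancel] at this
      linarith [hi1 v]
    have h2 : b (v - M) + (L + 2) ≤ b (v + 1) := by linarith
    have := mul_le_mul_of_nonneg_left h2 (show 0 ≤ 2 * M by linarith)
    have : 0 ≤ (M - 1) * (L - 2 * M) := mul_nonneg (by linarith) (by linarith)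
    linarith
  · intro v hv1 hv2
    simp only [sub_add_cancel] at hv1 hv2 ⊢
    have h2 : b (v - 1) + (L + 2) ≤ b (v + 1) := by linarith
    have := mul_le_mul_of_nonneg_left h2 (show 0 ≤ 2 * M by linarith)
    linarith
  · intro v hv1 hv2
    simp only [sub_add_cancel, not_lt] at hv1 hv2 ⊢
    have hlow : ∀ z, i v - L ≤ b z → v + 1 - M < z := by
      intro z hz
      by_contra hc
      push Not at hc
      have h1 := hw v z hz
      have h2 := hg (v + 1) (z + M) (by linarith)
      linarith
    obtain ⟨a, ha1, ha2⟩ := Int.exists_least_of_bdd (P := fun z => i v - L ≤ b z)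
      ⟨v + 1 - M, fun z hz => (hlow z hz).le⟩ ⟨v - 1, by linarith⟩
    have h1 := hw v a ha1
    have h2 := hlow a ha1
    have h3 := ha2 (v - 1) (by linarith)
    have h4 : b (a - 1) < i v - L := by
      by_contra hc
      push Not at hc
      have := ha2 (a - 1) hc
      linarith
    refine ⟨a - 1, by linarith, by linarith, ?_⟩
    rw [show a - 1 + M + 1 = a + M by ring]
    have h5 : b (a - 1) + (L + 2) ≤ b (a + M) := by linarith
    have := mul_le_mul_of_nonneg_left h5 (show 0 ≤ 2 * M by linarith)
    have : 0 ≤ (M - 1) * (L - 2 * M) := mul_nonneg (by linarith) (by linarith)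
    linarith

/-- Downlink sequences: around every active receiver there is an interval `[a, c]` of indices. -/
lemma jlr_downlink_seq (M L n P : ℤ) (b : ℤ → ℤ) (hM : 1 ≤ M) (hn : 0 < n)
    (hper : ∀ k, b (k + n) = b k + P)
    (hb : ∀ k, b k + 1 ≤ b (k + 1))
    (h : ∀ k, ∃ a c, a ≤ k ∧ k ≤ c ∧ c - a + 1 ≤ M ∧
      b (a - 1) + (L + (c - a + 1) + 1) ≤ b (c + 1)) :
    (2 * M + L) * n ≤ 2 * M * P := by
  have hg := jlr_gap b hb
  have hstep : ∀ k, b k + (L + 2 * M) ≤ b (k + 2 * M) := by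
    intro k
    obtain ⟨a, c, h1, h2, h3, h4⟩ := h (k + M)
    have h5 := hg (a - 1) k (by linarith)
    have h6 := hg (k + 2 * M) (c + 1) (by linarith)
    linarith
  have hit : ∀ j : ℕ, b 0 + j * (L + 2 * M) ≤ b (2 * M * j) := by
    intro j
    induction j with
    | zero => simp
    | succ j ih =>
      have := hstep (2 * M * j)
      push_cast
      rw [show 2 * M * ((j : ℤ) + 1) = 2 * M * j + 2 * M by ring]
      linarith
  have hp : ∀ j : ℕ, b (n * j) = b 0 + j * P := by
    intro j
    induction j with
    | zero => simp
    | succ j ih =>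
      have := hper (n * j)
      push_cast
      rw [show n * ((j : ℤ) + 1) = n * j + n by ring, this, ih]; ring
  have e1 := hit n.toNat
  have e2 := hp (2 * M).toNat
  rw [Int.toNat_of_nonneg hn.le] at e1
  rw [Int.toNat_of_nonneg (by linarith), mul_comm] at e2
  rw [e2] at e1
  linarith

/-- Periodic extension of a finite set of integers. -/
lemma jlr_periodic (B : Finset ℤ) (P : ℤ) (hB : B.Nonempty) (hP : ∀ x ∈ B, ∀ y ∈ B, x < y + P) :
    ∃ (b m : ℤ → ℤ), (∀ k, b (k + B.card) = b k + P) ∧ (∀ k, b k + 1 ≤ b (k + 1)) ∧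
      (∀ k, b k - m k * P ∈ B) := by
  have hc : 0 < (B.card : ℤ) := by exact_mod_cast hB.card_pos
  set n : ℤ := ((B.card : ℕ) : ℤ) with hn
  have hlt : ∀ k : ℤ, (k % n).toNat < B.card := by
    intro k
    have := Int.emod_nonneg k hc.ne'
    have := Int.emod_lt_of_pos k hc
    omega
  let e := B.orderEmbOfFin rfl
  refine ⟨fun k => e ⟨(k % n).toNat, hlt k⟩ + (k / n) * P, fun k => k / n, ?_, ?_, ?_⟩
  · intro k
    simp only [Int.add_emod_right, Int.add_ediv_of_dvd_right (dvd_refl n), Int.ediv_self hc.ne']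
    ring
  · intro k
    have e1 := Int.emod_add_mul_ediv k n
    have e2 := Int.emod_nonneg k hc.ne'
    have e3 := Int.emod_lt_of_pos k hc
    rw [Int.add_one_le_iff]
    simp only
    by_cases hk : k % n + 1 < n
    · have hd : (k + 1) / n = k / n ∧ (k + 1) % n = k % n + 1 := by
        rw [Int.ediv_emod_unique hc]
        refine ⟨by linarith, by linarith, hk⟩
      have : e ⟨(k % n).toNat, hlt k⟩ < e ⟨((k + 1) % n).toNat, hlt (k + 1)⟩ := by
        rw [OrderEmbedding.lt_iff_lt, Fin.mk_lt_mk]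
        omega
      rw [hd.1]
      linarith
    · have hd : (k + 1) / n = k / n + 1 ∧ (k + 1) % n = 0 := by
        rw [Int.ediv_emod_unique hc]
        refine ⟨by linarith, le_rfl, hc⟩
      have := hP _ (B.orderEmbOfFin_mem rfl ⟨(k % n).toNat, hlt k⟩) _
        (B.orderEmbOfFin_mem rfl ⟨((k + 1) % n).toNat, hlt (k + 1)⟩)
      rw [hd.1]
      change e _ < e _ + P at this
      linarith
  · intro k
    simp only [add_sub_cancel_right]
    exact B.orderEmbOfFin_mem rfl _

lemma jlr_copy (K L x y m m' : ℤ) (hK : 0 ≤ K) (hL : 0 ≤ L) (hx1 : 1 ≤ x) (hx2 : x ≤ K)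
    (h1 : 1 ≤ x + (m - m') * (K + L + 1)) (h2 : x + (m - m') * (K + L + 1) ≤ K + L) :
    m = m' := by
  rcases lt_trichotomy m m' with h | h | h
  · have : (m - m') * (K + L + 1) ≤ (-1) * (K + L + 1) :=
      mul_le_mul_of_nonneg_right (by linarith) (by linarith)
    linarith
  · exact h
  · have : 1 * (K + L + 1) ≤ (m - m') * (K + L + 1) :=
      mul_le_mul_of_nonneg_right (by linarith) (by linarith)
    linarith

lemma jlr_uplink (K L Nc : ℕ) (h1 : 1 ≤ Nc) (h2 : 2 * Nc ≤ L) (C : ℕ → Finset ℕ)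
    (hC : IsCellAssoc K Nc C) (S : UplinkScheme K L C) :
    (2 * (Nc : ℤ) + L) * S.D.card ≤ 2 * Nc * (K + L + 1) := by
  rcases S.D.eq_empty_or_nonempty with he | hne
  · rw [he]; simp; positivity
  set B : Finset ℤ := S.D.image (fun p => (p.2 : ℤ)) with hBdef
  have hcard : B.card = S.D.card := by
    apply Finset.card_image_of_injOn
    intro p hp q hq hpq
    by_contra hc
    have hpq' : (p.2 : ℤ) = q.2 := hpq
    exact (S.distinct p hp q hq hc).2 (by exact_mod_cast hpq')
  have hBr : ∀ x ∈ B, 1 ≤ x ∧ x ≤ (K : ℤ) := by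
    intro x hx
    obtain ⟨p, hp, rfl⟩ := Finset.mem_image.1 hx
    have := Finset.mem_Icc.1 (S.mem_range p hp).2
    omega
  obtain ⟨b, m, hper, hb, hm⟩ := jlr_periodic B ((K : ℤ) + L + 1) (hne.image _) (by
    intro x hx y hy
    have := hBr x hx
    have := hBr y hy
    omega)
  have hpk : ∀ k, ∃ p ∈ S.D, (p.2 : ℤ) = b k - m k * ((K : ℤ) + L + 1) := by
    intro k
    obtain ⟨p, hp, h⟩ := Finset.mem_image.1 (hm k)
    exact ⟨p, hp, h⟩
  choose pk hpD hp2 using hpk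
  have hr : ∀ k, (1 : ℤ) ≤ (pk k).1 ∧ ((pk k).1 : ℤ) ≤ K ∧ (1 : ℤ) ≤ (pk k).2 ∧
      ((pk k).2 : ℤ) ≤ K ∧ ((pk k).2 : ℤ) ≤ (pk k).1 ∧ ((pk k).1 : ℤ) ≤ (pk k).2 + L := by
    intro k
    have a1 := S.mem_range _ (hpD k)
    have a2 := S.conn _ (hpD k)
    rw [Finset.mem_Icc, Finset.mem_Icc] at a1
    unfold Connected at a2
    omega
  have hg := jlr_gap b hb
  have hinj : ∀ k l, k < l → b k < b l := by
    intro k l hkl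
    have := hg l k hkl.le
    linarith
  -- base stations seen in a window
  have hwin : ∀ k a, ((pk k).1 : ℤ) + m k * ((K : ℤ) + L + 1) - L ≤ b a →
      b a ≤ ((pk k).1 : ℤ) + m k * ((K : ℤ) + L + 1) →
      m a = m k ∧ Connected L (pk k).1 (pk a).2 := by
    intro k a c1 c2
    have c3 := hr k
    have c4 := hr a
    have c5 := hp2 a
    have c6 : m a = m k := by
      have e : (m a - m k) * ((K : ℤ) + L + 1) = b a - (pk a).2 - m k * ((K : ℤ) + L + 1) := by
        rw [c5]; ring
      rcases lt_trichotomy (m a) (m k) with h | h | h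
      · have : (m a - m k) * ((K : ℤ) + L + 1) ≤ (-1) * ((K : ℤ) + L + 1) :=
          mul_le_mul_of_nonneg_right (by linarith) (by positivity)
        linarith
      · exact h
      · have : 1 * ((K : ℤ) + L + 1) ≤ (m a - m k) * ((K : ℤ) + L + 1) :=
          mul_le_mul_of_nonneg_right (by linarith) (by positivity)
        linarith
    refine ⟨c6, ?_⟩
    rw [c6] at c5
    unfold Connected
    have d1 : ((pk a).2 : ℤ) ≤ (pk k).1 := by linarith
    have d2 : ((pk k).1 : ℤ) ≤ (pk a).2 + L := by linarith
    omega
  have main := jlr_uplink_seq Nc L B.card ((K : ℤ) + L + 1) b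
    (fun k => ((pk k).1 : ℤ) + m k * ((K : ℤ) + L + 1)) (by exact_mod_cast h1)
    (by exact_mod_cast h2) (by exact_mod_cast (hne.image _).card_pos) hper hb ?_ ?_ ?_ ?_
  · rwa [hcard] at main
  · intro k
    have := hr k
    have := hp2 k
    linarith
  · intro k
    have := hr k
    have := hp2 k
    linarith
  · intro k
    by_contra hc
    push Not at hc
    obtain ⟨c1, c2⟩ := hc
    have r1 := hr k
    have r2 := hp2 k
    have r3 := hr (k + 1)
    have r4 := hp2 (k + 1)
    have r5 := hb k
    obtain ⟨e1, e2⟩ := hwin k (k + 1) (by linarith) c1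
    obtain ⟨-, e3⟩ := hwin (k + 1) k (by linarith) (by linarith)
    have hne' : pk k ≠ pk (k + 1) := by
      intro h
      rw [← h, e1] at r4
      linarith
    have hd := (S.distinct _ (hpD k) _ (hpD (k + 1)) hne').1
    have z1 := (S.zf _ (hpD k) _ (hpD (k + 1)) hd e2).2
    have z2 := (S.zf _ (hpD (k + 1)) _ (hpD k) hd.symm e3).2
    exact S.lt_irrefl _ (hpD k) (S.lt_trans _ (hpD k) _ (hpD (k + 1)) _ (hpD k) z1 z2)
  · intro k a c1
    by_contra c2
    push Not at c2
    have hin : ∀ j ∈ Finset.range (Nc + 1), m (a + j) = m k ∧ (pk (a + j)).2 ∈ C (pk k).1 := by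
      intro j hj
      rw [Finset.mem_range] at hj
      have g1 := hg (a + j) a (by linarith)
      have g2 := hg (a + Nc) (a + j) (by omega)
      obtain ⟨e1, e2⟩ := hwin k (a + j) (by linarith) (by
        have : (j : ℤ) ≤ Nc := by omega
        linarith)
      refine ⟨e1, ?_⟩
      by_cases hd : pk k = pk (a + j)
      · rw [hd]; exact S.assoc _ (hpD _)
      · exact (S.zf _ (hpD k) _ (hpD (a + j)) (S.distinct _ (hpD k) _ (hpD _) hd).1 e2).1
    have hcard2 : (Finset.range (Nc + 1)).card ≤ (C (pk k).1).card := by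
      apply Finset.card_le_card_of_injOn (fun j : ℕ => (pk (a + j)).2)
      · intro j hj
        exact (hin j hj).2
      · intro j hj l hl hjl
        have hjl' : (pk (a + j)).2 = (pk (a + l)).2 := hjl
        have q1 := hp2 (a + j)
        have q2 := hp2 (a + l)
        rw [(hin j hj).1] at q1
        rw [(hin l hl).1] at q2
        rw [hjl'] at q1
        rcases lt_trichotomy j l with h | h | h
        · have := hinj (a + j) (a + l) (by omega)
          linarith
        · exact h
        · have := hinj (a + l) (a + j) (by omega)
          linarith
    rw [Finset.card_range] at hcard2
    have := (hC _ (S.mem_range _ (hpD k)).1).2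
    omega

/-- The maximal covered interval around an active receiver. -/
lemma jlr_interval (L i : ℕ) (A T : Finset ℕ) (f : ℕ → ℕ) (hT : ∃ j ∈ T, Connected L i j)
    (hf : ∀ r ∈ A, (∃ j ∈ T, Connected L r j) → f r ∈ T ∧ Connected L r (f r)) :
    ∃ x ∈ T, ∃ y ∈ T, x ≤ i ∧ i ≤ y + L ∧ x ≤ y ∧
      ∀ r ∈ A, x ≤ r → r ≤ y + L → (∃ j ∈ T, Connected L r j) ∧ f r ∈ T ∧ x ≤ f r ∧ f r ≤ y := by
  classical
  obtain ⟨j, hj, hji⟩ := hT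
  unfold Connected at *
  let F := (T ×ˢ T).filter (fun p : ℕ × ℕ => p.1 ≤ j ∧ j ≤ p.2 ∧
    ∀ z, p.1 ≤ z → z ≤ p.2 + L → ∃ t ∈ T, z - L ≤ t ∧ t ≤ z)
  have hF : F.Nonempty := by
    refine ⟨(j, j), ?_⟩
    simp only [F, Finset.mem_filter, Finset.mem_product]
    exact ⟨⟨hj, hj⟩, le_rfl, le_rfl, fun z z1 z2 => ⟨j, hj, by omega, z1⟩⟩
  obtain ⟨⟨x, y⟩, hxy, hmax⟩ := Finset.exists_max_image F (fun p => p.2 - p.1) hF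
  simp only [F, Finset.mem_filter, Finset.mem_product] at hxy hmax
  obtain ⟨⟨hx, hy⟩, hxj, hjy, hcov⟩ := hxy
  refine ⟨x, hx, y, hy, by omega, by omega, by omega, ?_⟩
  intro r hr hr1 hr2
  have hc := hcov r hr1 hr2
  obtain ⟨f1, f2, f3⟩ := hf r hr hc
  refine ⟨hc, f1, ?_, ?_⟩
  · by_contra hlt
    push Not at hlt
    have := hmax (f r, y) ⟨⟨f1, hy⟩, by omega, hjy, by
      intro z z1 z2
      by_cases hz : x ≤ z
      · exact hcov z hz z2
      · exact ⟨f r, f1, by omega, z1⟩⟩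
    simp only at this
    omega
  · by_contra hlt
    push Not at hlt
    have := hmax (x, f r) ⟨⟨hx, f1⟩, hxj, by omega, by
      intro z z1 z2
      by_cases hz : z ≤ y + L
      · exact hcov z z1 hz
      · exact ⟨f r, f1, by simp only at z2; omega, by omega⟩⟩
    simp only at this
    omega

lemma jlr_downlink (K L Nc : ℕ) (h1 : 1 ≤ Nc) (C : ℕ → Finset ℕ)
    (hC : IsCellAssoc K Nc C) (S : DownlinkScheme K L C) :
    (2 * (Nc : ℤ) + L) * S.A.card ≤ 2 * Nc * (K + L + 1) := by
  rcases S.A.eq_empty_or_nonempty with he | hne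
  · rw [he]; simp; positivity
  set B : Finset ℤ := S.A.image (fun p : ℕ => (p : ℤ)) with hBdef
  have hcard : B.card = S.A.card := by
    apply Finset.card_image_of_injective
    exact Nat.cast_injective
  have hBr : ∀ x ∈ B, 1 ≤ x ∧ x ≤ (K : ℤ) := by
    intro x hx
    obtain ⟨p, hp, rfl⟩ := Finset.mem_image.1 hx
    have := Finset.mem_Icc.1 (S.A_sub hp)
    omega
  obtain ⟨b, m, hper, hb, hm⟩ := jlr_periodic B ((K : ℤ) + L + 1) (hne.image _) (by
    intro x hx y hy
    have := hBr x hx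
    have := hBr y hy
    omega)
  have hpk : ∀ k, ∃ p ∈ S.A, (p : ℤ) = b k - m k * ((K : ℤ) + L + 1) := by
    intro k
    obtain ⟨p, hp, h⟩ := Finset.mem_image.1 (hm k)
    exact ⟨p, hp, h⟩
  choose rk hrA hrk using hpk
  have hg := jlr_gap b hb
  have hinj : ∀ k l, k < l → b k < b l := by
    intro k l hkl
    have := hg l k hkl.le
    linarith
  have main := jlr_downlink_seq Nc L B.card ((K : ℤ) + L + 1) b (by exact_mod_cast h1)
    (by exact_mod_cast (hne.image _).card_pos) hper hb ?_
  · rwa [hcard] at main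
  intro k
  obtain ⟨f, hf1, hf2⟩ := S.matching _ (hrA k)
  obtain ⟨x, hx, y, hy, hxi, hiy, hxy, hall⟩ :=
    jlr_interval L (rk k) S.A (S.T (rk k)) f (S.T_conn _ (hrA k)) hf1
  obtain ⟨hCs, hCc⟩ := hC _ (S.A_sub (hrA k))
  have hx1 := Finset.mem_Icc.1 (hCs (S.T_sub _ (hrA k) hx))
  have hy1 := Finset.mem_Icc.1 (hCs (S.T_sub _ (hrA k) hy))
  set lo : ℤ := (x : ℤ) + m k * ((K : ℤ) + L + 1) with hlo
  set hi : ℤ := (y : ℤ) + L + m k * ((K : ℤ) + L + 1) with hhi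
  have hk1 : lo ≤ b k := by
    have := hrk k
    have : (x : ℤ) ≤ rk k := by exact_mod_cast hxi
    linarith
  have hk2 : b k ≤ hi := by
    have := hrk k
    have : (rk k : ℤ) ≤ y + L := by exact_mod_cast hiy
    linarith
  obtain ⟨a, ha1, ha2⟩ := Int.exists_least_of_bdd (P := fun z => lo ≤ b z)
    ⟨k - (b k - lo), fun z hz => by
      by_contra hc
      push Not at hc
      have := hg k z (by linarith)
      linarith⟩ ⟨k, hk1⟩
  obtain ⟨c, hc1, hc2⟩ := Int.exists_greatest_of_bdd (P := fun z => b z ≤ hi)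
    ⟨k + (hi - b k), fun z hz => by
      by_contra hc
      push Not at hc
      have := hg z k (by linarith)
      linarith⟩ ⟨k, hk2⟩
  have hak := ha2 k hk1
  have hkc := hc2 k hk2
  have ha3 : b (a - 1) < lo := by
    by_contra hc
    push Not at hc
    have := ha2 (a - 1) hc
    linarith
  have hc3 : hi < b (c + 1) := by
    by_contra hc
    push Not at hc
    have := hc2 (c + 1) hc
    linarith
  obtain ⟨s, hs⟩ := Int.eq_ofNat_of_zero_le (show 0 ≤ c - a + 1 by linarith)
  have hin : ∀ j ∈ Finset.range s, m (a + j) = m k ∧ x ≤ rk (a + j) ∧ rk (a + j) ≤ y + L := by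
    intro j hj
    rw [Finset.mem_range] at hj
    have g1 := hg (a + j) a (by linarith)
    have g2 := hg c (a + j) (by omega)
    have g3 : 0 ≤ c - (a + j) := by omega
    have q1 := hrk (a + j)
    have q2 := Finset.mem_Icc.1 (S.A_sub (hrA (a + j)))
    have q3 : m (a + j) = m k := by
      apply jlr_copy K L (rk (a + j)) 0 _ _ (by positivity) (by positivity)
        (by exact_mod_cast q2.1) (by exact_mod_cast q2.2)
      · have : (1 : ℤ) ≤ x := by exact_mod_cast hx1.1
        linarith
      · have : (y : ℤ) ≤ K := by exact_mod_cast hy1.2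
        linarith
    rw [q3] at q1
    refine ⟨q3, ?_, ?_⟩
    · have : (x : ℤ) ≤ rk (a + j) := by linarith
      exact_mod_cast this
    · have : (rk (a + j) : ℤ) ≤ y + L := by linarith
      exact_mod_cast this
  have hcs : (Finset.range s).card ≤ (S.T (rk k) ∩ Finset.Icc x y).card := by
    apply Finset.card_le_card_of_injOn (fun j : ℕ => f (rk (a + j)))
    · intro j hj
      obtain ⟨-, e2, e3⟩ := hin j hj
      obtain ⟨-, e4, e5, e6⟩ := hall _ (hrA (a + j)) e2 e3
      simp only [Finset.coe_inter, Set.mem_inter_iff, Finset.mem_coe, Finset.mem_Icc]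
      exact ⟨e4, e5, e6⟩
    · intro j hj l hl hjl
      obtain ⟨e1, e2, e3⟩ := hin j hj
      obtain ⟨d1, d2, d3⟩ := hin l hl
      have hjl' := hf2 _ (hrA (a + j)) _ (hrA (a + l)) (hall _ (hrA (a + j)) e2 e3).1
        (hall _ (hrA (a + l)) d2 d3).1 hjl
      have q1 := hrk (a + j)
      have q2 := hrk (a + l)
      rw [e1] at q1
      rw [d1] at q2
      rw [hjl'] at q1
      rcases lt_trichotomy j l with h | h | h
      · have := hinj (a + j) (a + l) (by omega)
        linarith
      · exact h
      · have := hinj (a + l) (a + j) (by omega)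
        linarith
  rw [Finset.card_range] at hcs
  have hs1 : s ≤ Nc := hcs.trans ((Finset.card_le_card Finset.inter_subset_left).trans
    ((Finset.card_le_card (S.T_sub _ (hrA k))).trans hCc))
  have hs2 : s ≤ y + 1 - x := by
    have := hcs.trans (Finset.card_le_card Finset.inter_subset_right)
    rwa [Nat.card_Icc] at this
  refine ⟨a, c, hak, hkc, ?_, ?_⟩
  · rw [hs]; exact_mod_cast hs1
  · rw [hs]
    have : (s : ℤ) ≤ y + 1 - x := by omega
    have e : (Int.ofNat s : ℤ) = (s : ℤ) := rfl
    linarith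

/-- Optimality part of Theorem 2 for `Nc ≤ L/2`: asymptotically, the sum of the uplink
decoding pairs and the downlink active receivers for any shared cell association is at
most `(4Nc/(2Nc+L) + ε)·K`, i.e., the average uplink-downlink zero-forcing per-user DoF
equals `2Nc/(2Nc+L)`. -/
theorem joint_low_range_converse (L Nc : ℕ) (hL : 0 < L) (h1 : 1 ≤ Nc)
    (h2 : 2 * Nc ≤ L) :
    ∀ ε : ℝ, 0 < ε → ∃ K₀ : ℕ, ∀ K : ℕ, K₀ ≤ K →
      ∀ C : ℕ → Finset ℕ, IsCellAssoc K Nc C →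
        ∀ S : UplinkScheme K L C, ∀ T : DownlinkScheme K L C,
          ((S.D.card : ℝ) + (T.A.card : ℝ)) ≤
            ((4 * (Nc : ℝ)) / (2 * (Nc : ℝ) + (L : ℝ)) + ε) * (K : ℝ) := by
  intro ε hε
  obtain ⟨K₀, hK₀⟩ := exists_nat_ge (4 * (Nc : ℝ) / (2 * (Nc : ℝ) + (L : ℝ)) * ((L : ℝ) + 1) / ε)
  refine ⟨K₀, fun K hK C hC S T => ?_⟩
  have hu := jlr_uplink K L Nc h1 h2 C hC S
  have hd := jlr_downlink K L Nc h1 C hC T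
  have hu' : (2 * (Nc : ℝ) + L) * S.D.card ≤ 2 * Nc * (K + L + 1) := by exact_mod_cast hu
  have hd' : (2 * (Nc : ℝ) + L) * T.A.card ≤ 2 * Nc * (K + L + 1) := by exact_mod_cast hd
  have hpos : (0 : ℝ) < 2 * (Nc : ℝ) + L := by
    have : (0 : ℝ) < L := by exact_mod_cast hL
    positivity
  have hK' : (K₀ : ℝ) ≤ K := by exact_mod_cast hK
  have hb : 4 * (Nc : ℝ) / (2 * (Nc : ℝ) + (L : ℝ)) * ((L : ℝ) + 1) ≤ ε * K := by
    rw [div_le_iff₀ hε] at hK₀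
    nlinarith
  have hs : (S.D.card : ℝ) + T.A.card ≤
      4 * (Nc : ℝ) / (2 * (Nc : ℝ) + (L : ℝ)) * (K + L + 1) := by
    rw [div_mul_eq_mul_div, le_div_iff₀ hpos]
    linarith
  linarith
end
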